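/- Let q be a power of a prime and F_q the finite field with q elements, and let 0 < η < 1/8 and C > 0. There exists a constant c = c(η, C) > 0 such that the following holds for every A ⊆ F_q \ {0} with |A| ≥ 2. (i) If |A| ≤ q^{1/2} and |A ∩ cG| ≤ max{C|G|^{1/2}, η|A|} for every proper subfield G of F_q and every c ∈ F_q, then either |A + A|^{7}|A/A|^{4} ≥ c|A|^{12} or |A + A|^{6}|A/A|^{5} ≥ c|A|^{12}, and likewise either |A − A|^{7}|A/A|^{4} ≥ c|A|^{12} or |A − A|^{6}|A/A|^{5} ≥ c|A|^{12}. (ii) If |A| > η^{-1}q^{1/2}, then, without any subfield condition, |A + A|^{7}|A/A|^{4} ≥ c|A|^{10}q and |A − A|^{7}|A/A|^{4} ≥ c|A|^{10}q. -/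

import Mathlib

open scoped Classical Pointwise

noncomputable section

namespace STP

variable {F : Type} [Field F]

def collinearTriples (A B : Finset F) : ℕ :=
  (((A ×ˢ A ×ˢ A) ×ˢ (B ×ˢ B ×ˢ B)).filter fun x =>
    (x.1.2.1 - x.1.1) * (x.2.2.2 - x.2.1) = (x.1.2.2 - x.1.1) * (x.2.2.1 - x.2.1)).card

def IsLine (l : Set (F × F)) : Prop :=
  ∃ a b c : F, (a, b) ≠ (0, 0) ∧ l = {p : F × F | a * p.1 + b * p.2 = c}

def incidences (P : Finset (F × F)) (L : Finset (Set (F × F))) : ℕ :=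
  ((P ×ˢ L).filter fun x => x.1 ∈ x.2).card

def kIncidences (P : Finset (F × F)) (L : Finset (Set (F × F))) (k : ℕ) : ℕ :=
  (((Fintype.piFinset fun _ : Fin k => P) ×ˢ L).filter fun x => ∀ i, x.1 i ∈ x.2).card

def numLines (P : Finset (F × F)) : ℕ :=
  Set.ncard {l : Set (F × F) | IsLine l ∧ 2 ≤ (P.filter (· ∈ l)).card}

def addEnergy (X Y : Finset F) : ℕ :=
  (((X ×ˢ X) ×ˢ (Y ×ˢ Y)).filter fun t => t.1.1 + t.2.1 = t.1.2 + t.2.2).card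

def mulEnergy (A : Finset F) : ℕ :=
  (((A ×ˢ A) ×ˢ (A ×ˢ A)).filter fun t => t.1.1 * t.2.1 = t.1.2 * t.2.2).card

def quotSet (X : Finset F) : Set F :=
  {r : F | ∃ x1 ∈ X, ∃ x2 ∈ X, ∃ x3 ∈ X, ∃ x4 ∈ X, x3 ≠ x4 ∧ r = (x1 - x2) / (x3 - x4)}

def subfieldCond (A : Finset F) (C bound : ℝ) : Prop :=
  ∀ G : Subfield F, G ≠ ⊤ → ∀ c d : F,
    ((A.filter fun x => ∃ g ∈ G, x = c * g + d).card : ℝ) ≤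
      C * max ((Nat.card G : ℝ) ^ ((1:ℝ)/2)) bound

def linesOf [Fintype F] (P : Finset (F × F)) : Finset (Set (F × F)) :=
  Set.Finite.toFinset (Set.toFinite {l : Set (F × F) | IsLine l ∧ 2 ≤ (P.filter (· ∈ l)).card})

def tripleCount [Fintype F] (P : Finset (F × F)) : ℕ :=
  ∑ l ∈ linesOf P, ((P.filter (· ∈ l)).card) ^ 3

section Plu
variable {G : Type} [AddCommGroup G] [DecidableEq G]

lemma petridis_exists (X B : Finset G) (hX : X.Nonempty) :
    ∃ Y ⊆ X, Y.Nonempty ∧ (∀ A' ⊆ Y, (Y + B).card * A'.card ≤ (A' + B).card * Y.card) ∧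
      (Y + B).card * X.card ≤ (X + B).card * Y.card := by
  have hX' : X ∈ X.powerset.erase ∅ :=
    Finset.mem_erase_of_ne_of_mem hX.ne_empty (Finset.mem_powerset_self _)
  obtain ⟨Y, hY, hmin⟩ := Finset.exists_min_image (X.powerset.erase ∅)
    (fun U => ((U + B).card : ℚ) / U.card) ⟨X, hX'⟩
  rw [Finset.mem_erase, Finset.mem_powerset, ← Finset.nonempty_iff_ne_empty] at hY
  have key : ∀ A' ⊆ X, (Y + B).card * A'.card ≤ (A' + B).card * Y.card := by
    intro A' hA'
    rcases A'.eq_empty_or_nonempty with h | h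
    · simp [h]
    · have h1 := hmin A' (Finset.mem_erase_of_ne_of_mem h.ne_empty (Finset.mem_powerset.2 hA'))
      have p1 : (0:ℚ) < Y.card := by exact_mod_cast hY.1.card_pos
      have p2 : (0:ℚ) < A'.card := by exact_mod_cast h.card_pos
      rw [div_le_div_iff₀ p1 p2] at h1
      exact_mod_cast h1
  exact ⟨Y, hY.2, hY.1, fun A' h => key A' (h.trans hY.2), key X subset_rfl⟩

lemma petridis_step (X B C Y : Finset G) (hY : Y.Nonempty)
    (h : ∀ A' ⊆ Y, (Y + B).card * A'.card ≤ (A' + B).card * Y.card)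
    (h2 : (Y + B).card * X.card ≤ (X + B).card * Y.card) :
    (Y + (C + B)).card * X.card ≤ (X + B).card * (Y + C).card := by
  have h3 := Finset.pluennecke_petridis_inequality_add C h
  have e1 : Y + (C + B) = C + Y + B := by rw [← add_assoc, add_comm Y C]
  rw [e1, add_comm Y C]
  have hp := hY.card_pos
  refine Nat.le_of_mul_le_mul_right (c := Y.card) ?_ hp
  calc (C + Y + B).card * X.card * Y.card = ((C + Y + B).card * Y.card) * X.card := by ring
    _ ≤ ((Y + B).card * (C + Y).card) * X.card := by gcongr
    _ = ((Y + B).card * X.card) * (C + Y).card := by ring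
    _ ≤ ((X + B).card * Y.card) * (C + Y).card := by gcongr
    _ = _ := by ring

lemma petridis3 (X B : Finset G) (hX : X.Nonempty) :
    ∃ Y ⊆ X, Y.Nonempty ∧
      (Y + (B + B + B)).card * X.card ^ 3 ≤ (X + B).card ^ 3 * Y.card := by
  obtain ⟨Y, h1, h2, h3, h4⟩ := petridis_exists X B hX
  refine ⟨Y, h1, h2, ?_⟩
  have a := petridis_step X B (B + B) Y h2 h3 h4
  have b := petridis_step X B B Y h2 h3 h4
  calc (Y + (B + B + B)).card * X.card ^ 3
      = ((Y + (B + B + B)).card * X.card) * X.card ^ 2 := by ring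
    _ ≤ ((X + B).card * (Y + (B + B)).card) * X.card ^ 2 := by gcongr
    _ = (X + B).card * ((Y + (B + B)).card * X.card) * X.card := by ring
    _ ≤ (X + B).card * ((X + B).card * (Y + B).card) * X.card := by gcongr
    _ = (X + B).card ^ 2 * ((Y + B).card * X.card) := by ring
    _ ≤ (X + B).card ^ 2 * ((X + B).card * Y.card) := by gcongr
    _ = _ := by ring

lemma petridis2 (X B : Finset G) (hX : X.Nonempty) :
    ∃ Y ⊆ X, Y.Nonempty ∧
      (Y + (B + B)).card * X.card ^ 2 ≤ (X + B).card ^ 2 * Y.card := by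
  obtain ⟨Y, h1, h2, h3, h4⟩ := petridis_exists X B hX
  refine ⟨Y, h1, h2, ?_⟩
  have b := petridis_step X B B Y h2 h3 h4
  calc (Y + (B + B)).card * X.card ^ 2
      = ((Y + (B + B)).card * X.card) * X.card := by ring
    _ ≤ ((X + B).card * (Y + B).card) * X.card := by gcongr
    _ = (X + B).card * ((Y + B).card * X.card) := by ring
    _ ≤ (X + B).card * ((X + B).card * Y.card) := by gcongr
    _ = _ := by ring

lemma plu2 (X B C : Finset G) (hX : X.Nonempty) (hB : B.Nonempty) (hC : C.Nonempty) :
    ∃ Y ⊆ X, Y.Nonempty ∧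
      (Y + (B + C)).card * X.card ^ 2 ≤ 4 * (X + B).card * (X + C).card * Y.card := by
  obtain ⟨n, hn⟩ : ∃ n, n = (X + C).card := ⟨_, rfl⟩
  obtain ⟨m, hm⟩ : ∃ m, m = (X + B).card := ⟨_, rfl⟩
  have hn0 : 0 < n := hn ▸ (hX.add hC).card_pos
  have hm0 : 0 < m := hm ▸ (hX.add hB).card_pos
  have : NeZero n := ⟨hn0.ne'⟩
  have : NeZero m := ⟨hm0.ne'⟩
  let U : Finset (G × ZMod n × ZMod m) :=
    (B ×ˢ (Finset.univ ×ˢ {0})) ∪ (C ×ˢ ({0} ×ˢ Finset.univ))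
  let V : Finset (G × ZMod n × ZMod m) := X ×ˢ ({0} ×ˢ {0})
  have hV : V.Nonempty := by
    obtain ⟨x, hx⟩ := hX
    exact ⟨(x, 0, 0), by simp [V, hx]⟩
  obtain ⟨W, hWV, hW, hcard⟩ := petridis2 V U hV
  have hVc : V.card = X.card := by simp [V]
  have hVU : (V + U).card ≤ 2 * n * m := by
    have : V + U ⊆ ((X + B) ×ˢ (Finset.univ ×ˢ {0})) ∪ ((X + C) ×ˢ ({0} ×ˢ Finset.univ)) := by
      intro z hz
      obtain ⟨v, hv, u, hu, rfl⟩ := Finset.mem_add.1 hz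
      simp only [V, U, Finset.mem_union, Finset.mem_product, Finset.mem_singleton,
        Finset.mem_univ, true_and, and_true] at hv hu ⊢
      rcases hu with hu | hu
      · left
        exact ⟨Finset.add_mem_add hv.1 hu.1, by simp [hv.2.2, hu.2]⟩
      · right
        exact ⟨Finset.add_mem_add hv.1 hu.1, by simp [hv.2.1, hu.2]⟩
    refine (Finset.card_le_card this).trans ((Finset.card_union_le _ _).trans ?_)
    simp only [Finset.card_product, Finset.card_univ, ZMod.card, Finset.card_singleton]
    rw [← hn, ← hm]
    apply le_of_eq; ring
  refine ⟨W.image Prod.fst, ?_, hW.image _, ?_⟩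
  · intro y hy
    obtain ⟨w, hw, rfl⟩ := Finset.mem_image.1 hy
    have := hWV hw
    simp only [V, Finset.mem_product] at this
    exact this.1
  · set Y := W.image Prod.fst with hYdef
    have hmemW : ∀ y ∈ Y, (y, (0 : ZMod n), (0 : ZMod m)) ∈ W := by
      intro y hy
      obtain ⟨w, hw, rfl⟩ := Finset.mem_image.1 hy
      have := hWV hw
      simp only [V, Finset.mem_product, Finset.mem_singleton] at this
      have e : (w.1, (0 : ZMod n), (0 : ZMod m)) = w := by
        ext1
        · rfl
        · ext1
          · exact this.2.1.symm
          · exact this.2.2.symm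
      rw [e]; exact hw
    have hWc : W.card ≤ Y.card := by
      have : W ⊆ Y ×ˢ ({0} ×ˢ {0}) := by
        intro w hw
        have h1 := hWV hw
        simp only [V, Finset.mem_product] at h1 ⊢
        exact ⟨Finset.mem_image_of_mem _ hw, h1.2⟩
      simpa using Finset.card_le_card this
    have hbig : (Y + (B + C)).card * (n * m) ≤ (W + (U + U)).card := by
      have : (Y + (B + C)) ×ˢ ((Finset.univ : Finset (ZMod n)) ×ˢ (Finset.univ : Finset (ZMod m)))
          ⊆ W + (U + U) := by
        rintro ⟨z, i, j⟩ hz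
        simp only [Finset.mem_product, Finset.mem_univ, and_true] at hz
        obtain ⟨y, hy, t, ht, rfl⟩ := Finset.mem_add.1 hz
        obtain ⟨b, hb, c, hc, rfl⟩ := Finset.mem_add.1 ht
        refine Finset.mem_add.2 ⟨(y, 0, 0), hmemW y hy, (b, i, 0) + (c, 0, j), ?_, by simp⟩
        exact Finset.add_mem_add (by simp [U, hb]) (by simp [U, hc])
      have h := Finset.card_le_card this
      simpa [Finset.card_product, ZMod.card] using h
    rw [← hn, ← hm]
    have hnm : 0 < n * m := Nat.mul_pos hn0 hm0
    refine Nat.le_of_mul_le_mul_right (c := n * m) ?_ hnm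
    calc (Y + (B + C)).card * X.card ^ 2 * (n * m)
        = ((Y + (B + C)).card * (n * m)) * X.card ^ 2 := by ring
      _ ≤ (W + (U + U)).card * X.card ^ 2 := by gcongr
      _ = (W + (U + U)).card * V.card ^ 2 := by rw [hVc]
      _ ≤ (V + U).card ^ 2 * W.card := hcard
      _ ≤ (2 * n * m) ^ 2 * Y.card := by gcongr
      _ = _ := by ring

/-- passing from some subset of every large subset to a large subset -/
lemma large_subset (X C : Finset G) (k : ℝ)
    (h : ∀ Z ⊆ X, X.card < 2 * Z.card → ∃ Y ⊆ Z, Y.Nonempty ∧ ((Y + C).card : ℝ) ≤ k * Y.card) :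
    ∃ Y ⊆ X, X.card ≤ 2 * Y.card ∧ ((Y + C).card : ℝ) ≤ k * Y.card := by
  obtain ⟨Y, hY, hmax⟩ := Finset.exists_max_image
    (X.powerset.filter fun Y => ((Y + C).card : ℝ) ≤ k * Y.card) Finset.card
    ⟨∅, by simp⟩
  rw [Finset.mem_filter, Finset.mem_powerset] at hY
  refine ⟨Y, hY.1, ?_, hY.2⟩
  by_contra hlt
  push Not at hlt
  have hc := Finset.card_sdiff_add_card_eq_card hY.1
  obtain ⟨Z, hZ, hZn, hZc⟩ := h (X \ Y) Finset.sdiff_subset (by omega)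
  have hd : Disjoint Y Z :=
    Finset.disjoint_left.2 fun a ha hz => (Finset.mem_sdiff.1 (hZ hz)).2 ha
  have h1 := hmax (Y ∪ Z) (by
    rw [Finset.mem_filter, Finset.mem_powerset]
    refine ⟨Finset.union_subset hY.1 (hZ.trans Finset.sdiff_subset), ?_⟩
    rw [Finset.union_add, Finset.card_union_of_disjoint hd]
    have : (((Y + C) ∪ (Z + C)).card : ℝ) ≤ (Y + C).card + (Z + C).card := by
      exact_mod_cast Finset.card_union_le _ _
    push_cast
    linarith [hY.2])
  rw [Finset.card_union_of_disjoint hd] at h1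
  have := hZn.card_pos
  omega

lemma large3 (X B : Finset G) (hX : X.Nonempty) :
    ∃ Y ⊆ X, X.card ≤ 2 * Y.card ∧
      ((Y + (B + B + B)).card : ℝ) * X.card ^ 2 ≤ 8 * (X + B).card ^ 3 := by
  have hp : (0:ℝ) < X.card := by exact_mod_cast hX.card_pos
  obtain ⟨Y, h1, h2, h3⟩ := large_subset X (B + B + B) (8 * (X + B).card ^ 3 / X.card ^ 3) (by
    intro Z hZ hc
    have hZp : 0 < Z.card := by omega
    obtain ⟨Y, h1, h2, h3⟩ := petridis3 Z B (Finset.card_pos.1 hZp)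
    refine ⟨Y, h1, h2, ?_⟩
    have h3' : ((Y + (B + B + B)).card : ℝ) * Z.card ^ 3 ≤ (Z + B).card ^ 3 * Y.card := by
      exact_mod_cast h3
    have h4 : ((Z + B).card : ℝ) ≤ (X + B).card := by
      exact_mod_cast Finset.card_le_card (Finset.add_subset_add_right hZ)
    have h5 : (X.card : ℝ) ≤ 2 * Z.card := by exact_mod_cast hc.le
    rw [div_mul_eq_mul_div, le_div_iff₀ (by positivity)]
    calc ((Y + (B + B + B)).card : ℝ) * X.card ^ 3
        ≤ ((Y + (B + B + B)).card : ℝ) * (2 * Z.card) ^ 3 := by gcongr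
      _ = 8 * (((Y + (B + B + B)).card : ℝ) * Z.card ^ 3) := by ring
      _ ≤ 8 * ((Z + B).card ^ 3 * Y.card) := by gcongr
      _ ≤ 8 * ((X + B).card ^ 3 * Y.card) := by gcongr
      _ = _ := by ring)
  refine ⟨Y, h1, h2, ?_⟩
  have h4 : (Y.card : ℝ) ≤ X.card := by exact_mod_cast Finset.card_le_card h1
  calc ((Y + (B + B + B)).card : ℝ) * X.card ^ 2
      ≤ ((8:ℝ) * (X + B).card ^ 3 / X.card ^ 3 * Y.card) * X.card ^ 2 := by gcongr
    _ ≤ ((8:ℝ) * (X + B).card ^ 3 / X.card ^ 3 * X.card) * X.card ^ 2 := by gcongr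
    _ = _ := by field_simp

lemma large2 (X B C : Finset G) (hX : X.Nonempty) (hB : B.Nonempty) (hC : C.Nonempty) :
    ∃ Y ⊆ X, X.card ≤ 2 * Y.card ∧
      ((Y + (B + C)).card : ℝ) * X.card ≤ 16 * (X + B).card * (X + C).card := by
  have hp : (0:ℝ) < X.card := by exact_mod_cast hX.card_pos
  obtain ⟨Y, h1, h2, h3⟩ := large_subset X (B + C)
      (16 * (X + B).card * (X + C).card / X.card ^ 2) (by
    intro Z hZ hc
    have hZp : 0 < Z.card := by omega
    obtain ⟨Y, h1, h2, h3⟩ := plu2 Z B C (Finset.card_pos.1 hZp) hB hC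
    refine ⟨Y, h1, h2, ?_⟩
    have h3' : ((Y + (B + C)).card : ℝ) * Z.card ^ 2 ≤ 4 * (Z + B).card * (Z + C).card * Y.card := by
      exact_mod_cast h3
    have h4 : ((Z + B).card : ℝ) ≤ (X + B).card := by
      exact_mod_cast Finset.card_le_card (Finset.add_subset_add_right hZ)
    have h4' : ((Z + C).card : ℝ) ≤ (X + C).card := by
      exact_mod_cast Finset.card_le_card (Finset.add_subset_add_right hZ)
    have h5 : (X.card : ℝ) ≤ 2 * Z.card := by exact_mod_cast hc.le
    rw [div_mul_eq_mul_div, le_div_iff₀ (by positivity)]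
    calc ((Y + (B + C)).card : ℝ) * X.card ^ 2
        ≤ ((Y + (B + C)).card : ℝ) * (2 * Z.card) ^ 2 := by gcongr
      _ = 4 * (((Y + (B + C)).card : ℝ) * Z.card ^ 2) := by ring
      _ ≤ 4 * (4 * (Z + B).card * (Z + C).card * Y.card) := by gcongr
      _ ≤ 4 * (4 * (X + B).card * (X + C).card * Y.card) := by gcongr
      _ = _ := by ring)
  refine ⟨Y, h1, h2, ?_⟩
  have h4 : (Y.card : ℝ) ≤ X.card := by exact_mod_cast Finset.card_le_card h1
  calc ((Y + (B + C)).card : ℝ) * X.card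
      ≤ ((16:ℝ) * (X + B).card * (X + C).card / X.card ^ 2 * Y.card) * X.card := by gcongr
    _ ≤ ((16:ℝ) * (X + B).card * (X + C).card / X.card ^ 2 * X.card) * X.card := by gcongr
    _ = _ := by field_simp

end Plu

section Cover
variable [Fintype F]

lemma popular (U Z : Finset F) (v : F) (hv : v = 1 ∨ v = -1) :
    ∃ t : F, U.card * Z.card ≤ (U + Z).card * (U.filter fun x => ∃ z ∈ Z, x = t + v * z).card := by
  obtain ⟨t, -, ht⟩ := Finset.exists_max_image (Finset.univ : Finset F)
    (fun t => (U.filter fun x => ∃ z ∈ Z, x = t + v * z).card) ⟨0, Finset.mem_univ _⟩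
  refine ⟨t, ?_⟩
  set m := (U.filter fun x => ∃ z ∈ Z, x = t + v * z).card with hm
  have h1 := Finset.le_card_add_mul_addEnergy U Z
  have h2 : Finset.addEnergy U Z ≤ m * (U.card * Z.card) := by
    rw [Finset.addEnergy, ← Finset.card_product]
    rcases hv with rfl | rfl
    · refine Finset.card_le_mul_card_image_of_maps_to (f := fun x => (x.1.1, x.2.2)) ?_ _ ?_
      · intro a ha
        simp only [Finset.mem_filter, Finset.mem_product] at ha ⊢
        exact ⟨ha.1.1.1, ha.1.2.2⟩
      · rintro ⟨x, z⟩ -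
        refine le_trans ?_ (ht (x - z) (Finset.mem_univ _))
        refine Finset.card_le_card_of_injOn (fun a => a.1.2) ?_ ?_
        · rintro ⟨⟨a, b⟩, c, d⟩ ha
          simp only [Finset.coe_filter, Finset.mem_filter, Finset.mem_product, Set.mem_setOf_eq,
            Prod.mk.injEq] at ha ⊢
          obtain ⟨⟨⟨⟨h1, h2⟩, h3, h4⟩, h5⟩, rfl, rfl⟩ := ha
          exact ⟨h2, c, h3, by linear_combination -h5⟩
        · rintro ⟨⟨a, b⟩, c, d⟩ ha ⟨⟨a', b'⟩, c', d'⟩ ha' hh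
          simp only [Finset.coe_filter, Finset.mem_filter, Finset.mem_product, Set.mem_setOf_eq,
            Prod.mk.injEq] at ha ha' hh ⊢
          obtain ⟨⟨-, h5⟩, rfl, rfl⟩ := ha
          obtain ⟨⟨-, h6⟩, rfl, rfl⟩ := ha'
          subst hh
          refine ⟨⟨rfl, rfl⟩, ?_, rfl⟩
          linear_combination h5 - h6
    · refine Finset.card_le_mul_card_image_of_maps_to (f := fun x => (x.1.1, x.2.1)) ?_ _ ?_
      · intro a ha
        simp only [Finset.mem_filter, Finset.mem_product] at ha ⊢
        exact ⟨ha.1.1.1, ha.1.2.1⟩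
      · rintro ⟨x, z⟩ -
        refine le_trans ?_ (ht (x + z) (Finset.mem_univ _))
        refine Finset.card_le_card_of_injOn (fun a => a.1.2) ?_ ?_
        · rintro ⟨⟨a, b⟩, c, d⟩ ha
          simp only [Finset.coe_filter, Finset.mem_filter, Finset.mem_product, Set.mem_setOf_eq,
            Prod.mk.injEq] at ha ⊢
          obtain ⟨⟨⟨⟨h1, h2⟩, h3, h4⟩, h5⟩, rfl, rfl⟩ := ha
          exact ⟨h2, d, h4, by linear_combination -h5⟩
        · rintro ⟨⟨a, b⟩, c, d⟩ ha ⟨⟨a', b'⟩, c', d'⟩ ha' hh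
          simp only [Finset.coe_filter, Finset.mem_filter, Finset.mem_product, Set.mem_setOf_eq,
            Prod.mk.injEq] at ha ha' hh ⊢
          obtain ⟨⟨-, h5⟩, rfl, rfl⟩ := ha
          obtain ⟨⟨-, h6⟩, rfl, rfl⟩ := ha'
          subst hh
          refine ⟨⟨rfl, rfl⟩, rfl, ?_⟩
          linear_combination h6 - h5
  rcases Nat.eq_zero_or_pos (U.card * Z.card) with h0 | h0
  · rw [h0]; exact Nat.zero_le _
  · refine Nat.le_of_mul_le_mul_right (c := U.card * Z.card) ?_ h0
    calc U.card * Z.card * (U.card * Z.card) = U.card ^ 2 * Z.card ^ 2 := by ring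
      _ ≤ (U + Z).card * Finset.addEnergy U Z := h1
      _ ≤ (U + Z).card * (m * (U.card * Z.card)) := by gcongr
      _ = _ := by ring

lemma popular' (U Y : Finset F) (s u : F) (hs : s = 1 ∨ s = -1) (hu : u = 1 ∨ u = -1) :
    ∃ t : F, U.card * Y.card ≤
      (U + s • Y).card * (U.filter fun x => ∃ y ∈ Y, x = t + u * y).card := by
  have hs0 : s ≠ 0 := by rcases hs with rfl | rfl <;> simp
  have hss : s * s = 1 := by rcases hs with rfl | rfl <;> simp
  obtain ⟨t, ht⟩ := popular U (s • Y) (u * s) (by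
    rcases hs with rfl | rfl <;> rcases hu with rfl | rfl <;> simp)
  refine ⟨t, ?_⟩
  have hc : (s • Y).card = Y.card := by
    rw [Finset.smul_finset_def]
    exact Finset.card_image_of_injective _ (mul_right_injective₀ hs0)
  rw [hc] at ht
  refine ht.trans ?_
  refine Nat.mul_le_mul_left _ (Finset.card_le_card ?_)
  intro x hx
  rw [Finset.mem_filter] at hx ⊢
  obtain ⟨hx, z, hz, rfl⟩ := hx
  obtain ⟨y, hy, rfl⟩ := Finset.mem_smul_finset.1 hz
  refine ⟨hx, y, hy, ?_⟩
  rw [smul_eq_mul]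
  linear_combination u * y * hss

lemma cover (X D : Finset F) (hD : D.Nonempty) (s u : F) (hs : s = 1 ∨ s = -1)
    (hu : u = 1 ∨ u = -1) :
    ∃ X' ⊆ X, X.card ≤ 2 * X'.card ∧ ∃ T : Finset F, T.card * D.card ≤ 2 * (X + s • D).card ∧
      ∀ x ∈ X', ∃ t ∈ T, ∃ d ∈ D, x = t + u * d := by
  rcases X.eq_empty_or_nonempty with rfl | hX
  · exact ⟨∅, by simp, by simp, ∅, by simp, by simp⟩
  let cov : Finset F → Finset F := fun T => X.filter fun x => ∃ t ∈ T, ∃ d ∈ D, x = t + u * d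
  obtain ⟨T, -, hT⟩ := Finset.exists_max_image (Finset.univ : Finset (Finset F))
    (fun T => (2 * (X + s • D).card * (cov T).card : ℤ) - T.card * X.card * D.card)
    ⟨∅, Finset.mem_univ _⟩
  have hXp : 0 < X.card := hX.card_pos
  have hDp : 0 < D.card := hD.card_pos
  have hcX : (cov T).card ≤ X.card := Finset.card_le_card (Finset.filter_subset _ _)
  refine ⟨cov T, Finset.filter_subset _ _, ?_, T, ?_, fun x hx => (Finset.mem_filter.1 hx).2⟩
  · by_contra hlt
    push Not at hlt
    obtain ⟨t, ht⟩ := popular' (X \ cov T) D s u hs hu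
    have hcs : cov T ⊆ X := Finset.filter_subset _ _
    have hU := Finset.card_sdiff_add_card_eq_card hcs
    have h1 := hT (insert t T) (Finset.mem_univ _)
    set c := ((X \ cov T).filter fun x => ∃ y ∈ D, x = t + u * y) with hc
    have h2 : (cov T).card + c.card ≤ (cov (insert t T)).card := by
      rw [← Finset.card_union_of_disjoint]
      · apply Finset.card_le_card
        intro x hx
        rcases Finset.mem_union.1 hx with hx | hx
        · obtain ⟨hx1, t', ht', hd⟩ := Finset.mem_filter.1 hx
          exact Finset.mem_filter.2 ⟨hx1, t', Finset.mem_insert_of_mem ht', hd⟩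
        · obtain ⟨hx1, hd⟩ := Finset.mem_filter.1 hx
          exact Finset.mem_filter.2 ⟨(Finset.mem_sdiff.1 hx1).1, t, Finset.mem_insert_self _ _, hd⟩
      · refine Finset.disjoint_left.2 fun a ha hz => ?_
        exact (Finset.mem_sdiff.1 (Finset.mem_filter.1 hz).1).2 ha
    have h3 : (insert t T).card ≤ T.card + 1 := Finset.card_insert_le _ _
    have h4 : ((X \ cov T) + s • D).card ≤ (X + s • D).card :=
      Finset.card_le_card (Finset.add_subset_add_right Finset.sdiff_subset)
    have h5 : (X \ cov T).card * D.card ≤ (X + s • D).card * c.card :=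
      ht.trans (by gcongr)
    have h6 : X.card * D.card < 2 * ((X \ cov T).card * D.card) := by
      rw [← mul_assoc]
      exact Nat.mul_lt_mul_of_pos_right (by omega) hDp
    have h7 : ((insert t T).card * X.card * D.card : ℤ) ≤
        T.card * X.card * D.card + X.card * D.card := by
      have : (insert t T).card * X.card * D.card ≤ (T.card + 1) * X.card * D.card := by gcongr
      have h8 : ((insert t T).card * X.card * D.card : ℤ) ≤ (T.card + 1) * X.card * D.card := by
        exact_mod_cast this
      linarith
    have h8 : (2 * (X + s • D).card * ((cov T).card + c.card) : ℤ) ≤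
        2 * (X + s • D).card * (cov (insert t T)).card := by
      have : 2 * (X + s • D).card * ((cov T).card + c.card) ≤
        2 * (X + s • D).card * (cov (insert t T)).card := by gcongr
      exact_mod_cast this
    zify at h5 h6
    linarith
  · have h1 := hT ∅ (Finset.mem_univ _)
    have h2 : (0:ℤ) ≤ (2 * (X + s • D).card * (cov T).card : ℤ) - T.card * X.card * D.card := by
      refine le_trans ?_ h1
      simp
      positivity
    have h3 : T.card * X.card * D.card ≤ 2 * (X + s • D).card * (cov T).card := by
      zify; linarith
    refine Nat.le_of_mul_le_mul_right (c := X.card) ?_ hXp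
    calc T.card * D.card * X.card = T.card * X.card * D.card := by ring
      _ ≤ 2 * (X + s • D).card * (cov T).card := h3
      _ ≤ _ := by gcongr

lemma card_smul0 (b : F) (hb : b ≠ 0) (Y : Finset F) : (b • Y).card = Y.card := by
  rw [Finset.smul_finset_def]
  exact Finset.card_image_of_injective _ (mul_right_injective₀ hb)

lemma cover' (A X : Finset F) (hX : X ⊆ A) (b s u : F) (hs : s = 1 ∨ s = -1)
    (hu : u = 1 ∨ u = -1) (N Q : ℝ) (hN : 0 < N) (hb0 : b ≠ 0)
    (hb : N ≤ (A.filter fun x => b * x ∈ A).card) (hQ : ((A + s • A).card : ℝ) ≤ Q) :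
    ∃ X' ⊆ X, X.card ≤ 2 * X'.card ∧ ∃ T : Finset F, (T.card : ℝ) ≤ 2 * Q / N ∧
      ∀ x ∈ X', ∃ t ∈ T, ∃ a ∈ A, b * x = t + u * a := by
  set D0 := A.filter fun x => b * x ∈ A with hD0
  have hcD : (b • D0).card = D0.card := card_smul0 b hb0 D0
  have hne : (b • D0).Nonempty := by
    rw [← Finset.card_pos, hcD]
    have : (0:ℝ) < D0.card := lt_of_lt_of_le hN hb
    exact_mod_cast this
  obtain ⟨X', h1, h2, T, h3, h4⟩ := cover (b • X) (b • D0) hne s u hs hu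
  refine ⟨X.filter fun x => b * x ∈ X', Finset.filter_subset _ _, ?_, T, ?_, ?_⟩
  · rw [card_smul0 b hb0] at h2
    refine h2.trans ?_
    gcongr 2 * ?_
    rw [← card_smul0 b hb0 (X.filter fun x => b * x ∈ X')]
    apply Finset.card_le_card
    intro z hz
    obtain ⟨x, hx, rfl⟩ := Finset.mem_smul_finset.1 (h1 hz)
    exact Finset.mem_smul_finset.2 ⟨x, Finset.mem_filter.2 ⟨hx, hz⟩, rfl⟩
  · have h5 : (b • X + s • (b • D0)).card ≤ (A + s • A).card := by
      rw [← card_smul0 b hb0 (A + s • A)]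
      apply Finset.card_le_card
      intro z hz
      obtain ⟨p, hp, q, hq, rfl⟩ := Finset.mem_add.1 hz
      obtain ⟨x, hx, rfl⟩ := Finset.mem_smul_finset.1 hp
      obtain ⟨w, hw, rfl⟩ := Finset.mem_smul_finset.1 hq
      obtain ⟨y, hy, rfl⟩ := Finset.mem_smul_finset.1 hw
      refine Finset.mem_smul_finset.2 ⟨x + s • y, Finset.add_mem_add (hX hx)
        (Finset.smul_mem_smul_finset (Finset.mem_filter.1 hy).1), ?_⟩
      simp only [smul_eq_mul]; ring
    rw [le_div_iff₀ hN]
    have h6 : (T.card : ℝ) * (b • D0).card ≤ 2 * (b • X + s • (b • D0)).card := by exact_mod_cast h3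
    have h7 : ((b • X + s • (b • D0)).card : ℝ) ≤ (A + s • A).card := by exact_mod_cast h5
    rw [hcD] at h6
    calc (T.card : ℝ) * N ≤ T.card * D0.card := by gcongr
      _ ≤ _ := h6
      _ ≤ 2 * Q := by linarith
  · intro x hx
    obtain ⟨t, ht, d, hd, e⟩ := h4 _ (Finset.mem_filter.1 hx).2
    obtain ⟨y, hy, rfl⟩ := Finset.mem_smul_finset.1 hd
    exact ⟨t, ht, _, (Finset.mem_filter.1 hy).2, e⟩

lemma assemble3 (W T1 T2 T3 V : Finset F)
    (h : ∀ w ∈ W, ∃ t1 ∈ T1, ∃ t2 ∈ T2, ∃ t3 ∈ T3, ∃ v ∈ V, w = t1 + t2 + t3 + v)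
    (τ : ℝ) (h1 : (T1.card : ℝ) ≤ τ) (h2 : (T2.card : ℝ) ≤ τ) (h3 : (T3.card : ℝ) ≤ τ) :
    (W.card : ℝ) ≤ τ ^ 3 * V.card := by
  have hsub : W ⊆ T1 + T2 + T3 + V := by
    intro w hw
    obtain ⟨t1, h1, t2, h2, t3, h3, v, hv, rfl⟩ := h w hw
    exact Finset.add_mem_add (Finset.add_mem_add (Finset.add_mem_add h1 h2) h3) hv
  have hc : W.card ≤ T1.card * T2.card * T3.card * V.card := by
    refine (Finset.card_le_card hsub).trans (Finset.card_add_le.trans ?_)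
    gcongr
    refine Finset.card_add_le.trans ?_
    gcongr
    exact Finset.card_add_le
  have hc' : (W.card : ℝ) ≤ T1.card * T2.card * T3.card * V.card := by exact_mod_cast hc
  have hτ : 0 ≤ τ := le_trans (by positivity) h1
  calc (W.card : ℝ) ≤ T1.card * T2.card * T3.card * V.card := hc'
    _ ≤ τ * τ * τ * V.card := by gcongr
    _ = _ := by ring

lemma assemble4 (W T1 T2 T3 T4 V : Finset F)
    (h : ∀ w ∈ W, ∃ t1 ∈ T1, ∃ t2 ∈ T2, ∃ t3 ∈ T3, ∃ t4 ∈ T4, ∃ v ∈ V, w = t1 + t2 + t3 + t4 + v)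
    (τ : ℝ) (h1 : (T1.card : ℝ) ≤ τ) (h2 : (T2.card : ℝ) ≤ τ) (h3 : (T3.card : ℝ) ≤ τ)
    (h4 : (T4.card : ℝ) ≤ τ) :
    (W.card : ℝ) ≤ τ ^ 4 * V.card := by
  have hτ : 0 ≤ τ := le_trans (by positivity) h1
  have := assemble3 W T1 T2 T3 (T4 + V) (by
    intro w hw
    obtain ⟨t1, h1, t2, h2, t3, h3, t4, h4, v, hv, rfl⟩ := h w hw
    exact ⟨t1, h1, t2, h2, t3, h3, t4 + v, Finset.add_mem_add h4 hv, by ring⟩) τ h1 h2 h3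
  have h5 : ((T4 + V).card : ℝ) ≤ T4.card * V.card := by exact_mod_cast Finset.card_add_le
  calc (W.card : ℝ) ≤ τ ^ 3 * (T4 + V).card := this
    _ ≤ τ ^ 3 * (τ * V.card) := by
      gcongr
      exact h5.trans (by gcongr)
    _ = _ := by ring

/-- image of `X × Y` under `(x, y) ↦ c x + s d y`, covered after passing to subsets -/
lemma est4 (A X Y : Finset F) (hX : X ⊆ A) (hY : Y ⊆ A) (s : F) (hs : s = 1 ∨ s = -1)
    (N Q : ℝ) (hN : 0 < N) (hQ : ((A + s • A).card : ℝ) ≤ Q) (b1 b2 b3 b4 : F)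
    (z1 : b1 ≠ 0) (z2 : b2 ≠ 0) (z3 : b3 ≠ 0) (z4 : b4 ≠ 0)
    (h1 : N ≤ (A.filter fun x => b1 * x ∈ A).card)
    (h2 : N ≤ (A.filter fun x => b2 * x ∈ A).card)
    (h3 : N ≤ (A.filter fun x => b3 * x ∈ A).card)
    (h4 : N ≤ (A.filter fun x => b4 * x ∈ A).card) :
    ∃ X' ⊆ X, X.card ≤ 4 * X'.card ∧ ∃ Y' ⊆ Y, Y.card ≤ 4 * Y'.card ∧
      (((b3 - b4) • X' + (s * (b1 - b2)) • Y').card : ℝ) ≤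
        (2 * Q / N) ^ 4 * (A + (s • A + s • A + s • A)).card := by
  have hss : s * s = 1 := by rcases hs with rfl | rfl <;> simp
  have hns : -s = 1 ∨ -s = -1 := by rcases hs with rfl | rfl <;> simp
  obtain ⟨X1, x1, x2, T3, t3, x3⟩ := cover' A X hX b3 s 1 hs (Or.inl rfl) N Q hN z3 h3 hQ
  obtain ⟨X2, x4, x5, T4, t4, x6⟩ :=
    cover' A X1 (x1.trans hX) b4 s (-s) hs hns N Q hN z4 h4 hQ
  obtain ⟨Y1, y1, y2, T1, t1, y3⟩ := cover' A Y hY b1 s 1 hs (Or.inl rfl) N Q hN z1 h1 hQ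
  obtain ⟨Y2, y4, y5, T2, t2, y6⟩ :=
    cover' A Y1 (y1.trans hY) b2 s (-1) hs (Or.inr rfl) N Q hN z2 h2 hQ
  refine ⟨X2, x4.trans x1, by omega, Y2, y4.trans y1, by omega, ?_⟩
  have hs0 : s ≠ 0 := by rcases hs with rfl | rfl <;> simp
  have hn1 : ∀ Z : Finset F, ((-1 : F) • Z).card = Z.card := card_smul0 (-1) (by simp)
  refine assemble4 _ T3 ((-1 : F) • T4) (s • T1) ((-s) • T2) _ ?_ _ t3 ?_ ?_ ?_
  · intro w hw
    obtain ⟨p, hp, q, hq, rfl⟩ := Finset.mem_add.1 hw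
    obtain ⟨x, hx, rfl⟩ := Finset.mem_smul_finset.1 hp
    obtain ⟨y, hy, rfl⟩ := Finset.mem_smul_finset.1 hq
    obtain ⟨p3, m3, a3, n3, e3⟩ := x3 x (x4 hx)
    obtain ⟨p4, m4, a4, n4, e4⟩ := x6 x hx
    obtain ⟨p1, m1, a1, n1, e1⟩ := y3 y (y4 hy)
    obtain ⟨p2, m2, a2, n2, e2⟩ := y6 y hy
    refine ⟨p3, m3, _, Finset.smul_mem_smul_finset m4, _, Finset.smul_mem_smul_finset m1, _,
      Finset.smul_mem_smul_finset m2, a3 + (s • a4 + s • a1 + s • a2), ?_, ?_⟩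
    · refine Finset.add_mem_add n3 (Finset.add_mem_add (Finset.add_mem_add ?_ ?_) ?_) <;>
        apply Finset.smul_mem_smul_finset <;> assumption
    · simp only [smul_eq_mul]
      linear_combination e3 - e4 + s * e1 - s * e2
  · rw [hn1]; exact t4
  · rw [card_smul0 s hs0]; exact t1
  · rw [card_smul0 (-s) (neg_ne_zero.2 hs0)]; exact t2

lemma est3 (A X Y : Finset F) (hX : X ⊆ A) (hY : Y ⊆ A) (s : F) (hs : s = 1 ∨ s = -1)
    (N Q : ℝ) (hN : 0 < N) (hQ : ((A + s • A).card : ℝ) ≤ Q) (b1 b2 b3 b4 : F)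
    (z2 : b2 ≠ 0) (z3 : b3 ≠ 0) (z4 : b4 ≠ 0)
    (h1 : ∀ y ∈ Y, b1 * y ∈ A)
    (h2 : N ≤ (A.filter fun x => b2 * x ∈ A).card)
    (h3 : N ≤ (A.filter fun x => b3 * x ∈ A).card)
    (h4 : N ≤ (A.filter fun x => b4 * x ∈ A).card) :
    ∃ X' ⊆ X, X.card ≤ 4 * X'.card ∧ ∃ Y' ⊆ Y, Y.card ≤ 2 * Y'.card ∧
      (((b3 - b4) • X' + (s * (b1 - b2)) • Y').card : ℝ) ≤
        (2 * Q / N) ^ 3 * (A + (s • A + s • A + s • A)).card := by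
  have hss : s * s = 1 := by rcases hs with rfl | rfl <;> simp
  have hns : -s = 1 ∨ -s = -1 := by rcases hs with rfl | rfl <;> simp
  obtain ⟨X1, x1, x2, T3, t3, x3⟩ := cover' A X hX b3 s 1 hs (Or.inl rfl) N Q hN z3 h3 hQ
  obtain ⟨X2, x4, x5, T4, t4, x6⟩ :=
    cover' A X1 (x1.trans hX) b4 s (-s) hs hns N Q hN z4 h4 hQ
  obtain ⟨Y2, y4, y5, T2, t2, y6⟩ :=
    cover' A Y hY b2 s (-1) hs (Or.inr rfl) N Q hN z2 h2 hQ
  refine ⟨X2, x4.trans x1, by omega, Y2, y4, by omega, ?_⟩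
  have hs0 : s ≠ 0 := by rcases hs with rfl | rfl <;> simp
  have hn1 : ∀ Z : Finset F, ((-1 : F) • Z).card = Z.card := card_smul0 (-1) (by simp)
  refine assemble3 _ T3 ((-1 : F) • T4) ((-s) • T2) _ ?_ _ t3 ?_ ?_
  · intro w hw
    obtain ⟨p, hp, q, hq, rfl⟩ := Finset.mem_add.1 hw
    obtain ⟨x, hx, rfl⟩ := Finset.mem_smul_finset.1 hp
    obtain ⟨y, hy, rfl⟩ := Finset.mem_smul_finset.1 hq
    obtain ⟨p3, m3, a3, n3, e3⟩ := x3 x (x4 hx)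
    obtain ⟨p4, m4, a4, n4, e4⟩ := x6 x hx
    obtain ⟨p2, m2, a2, n2, e2⟩ := y6 y hy
    have n1 := h1 y (y4 hy)
    refine ⟨p3, m3, _, Finset.smul_mem_smul_finset m4, _,
      Finset.smul_mem_smul_finset m2, a3 + (s • a4 + s • (b1 * y) + s • a2), ?_, ?_⟩
    · refine Finset.add_mem_add n3 (Finset.add_mem_add (Finset.add_mem_add ?_ ?_) ?_) <;>
        apply Finset.smul_mem_smul_finset <;> assumption
    · simp only [smul_eq_mul]
      linear_combination e3 - e4 - s * e2
  · rw [hn1]; exact t4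
  · rw [card_smul0 (-s) (neg_ne_zero.2 hs0)]; exact t2

end Cover

section Core

lemma quot_neg (B : Finset F) (r : F) (h : r ∈ quotSet B) : -r ∈ quotSet B := by
  obtain ⟨a, ha, b, hb, c, hc, d, hd, hne, rfl⟩ := h
  exact ⟨b, hb, a, ha, c, hc, d, hd, hne, by ring⟩

lemma quot_inv (B : Finset F) (r : F) (h : r ∈ quotSet B) : r⁻¹ ∈ quotSet B := by
  obtain ⟨a, ha, b, hb, c, hc, d, hd, hne, rfl⟩ := h
  by_cases hab : a = b
  · exact ⟨a, ha, b, hb, c, hc, d, hd, hne, by simp [hab]⟩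
  · exact ⟨c, hc, d, hd, a, ha, b, hb, hab, by rw [inv_div]⟩

lemma quot_sign (B : Finset F) (s r : F) (hs : s = 1 ∨ s = -1) (h : s * r ∈ quotSet B) :
    r ∈ quotSet B := by
  rcases hs with rfl | rfl
  · simpa using h
  · simpa using quot_neg B _ h

lemma quot_mono {B B' : Finset F} (h : B ⊆ B') : quotSet B ⊆ quotSet B' := by
  rintro r ⟨a, ha, b, hb, c, hc, d, hd, hne, rfl⟩
  exact ⟨a, h ha, b, h hb, c, h hc, d, h hd, hne, rfl⟩

lemma inj_card (B X Y : Finset F) (hX : X ⊆ B) (hY : Y ⊆ B) (c d : F) (hc : c ≠ 0)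
    (h : d / c ∉ quotSet B) : X.card * Y.card ≤ (c • X + d • Y).card := by
  rw [← Finset.card_product]
  refine Finset.card_le_card_of_injOn (fun p => c • p.1 + d • p.2) ?_ ?_
  · intro p hp
    have hp := Finset.mem_product.1 (Finset.mem_coe.1 hp)
    exact Finset.mem_coe.2 (Finset.add_mem_add (Finset.smul_mem_smul_finset hp.1)
      (Finset.smul_mem_smul_finset hp.2))
  · rintro ⟨x, y⟩ hp ⟨x', y'⟩ hp' e
    have hp := Finset.mem_product.1 (Finset.mem_coe.1 hp)
    have hp' := Finset.mem_product.1 (Finset.mem_coe.1 hp')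
    simp only [smul_eq_mul] at e hp hp'
    have hy : y = y' := by
      by_contra hne
      refine h ⟨x', hX hp'.1, x, hX hp.1, y, hY hp.2, y', hY hp'.2, hne, ?_⟩
      rw [div_eq_div_iff hc (sub_ne_zero.2 hne)]
      linear_combination e
    subst hy
    have : x = x' := mul_left_cancel₀ hc (by linear_combination e)
    rw [this]

variable [Fintype F]

lemma case0 (A B0 Bs : Finset F) (hB0A : B0 ⊆ A) (hBsB0 : Bs ⊆ B0) (h0 : (0:F) ∉ A)
    (s : F) (hs : s = 1 ∨ s = -1) (N Q V : ℝ) (hN : 0 < N)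
    (hQ : ((A + s • A).card : ℝ) ≤ Q) (hV : ((A + (s • A + s • A + s • A)).card : ℝ) ≤ V)
    (hB0 : ∀ b ∈ B0, N ≤ (A.filter fun x => b * x ∈ A).card)
    (r : F) (hr : r ∈ quotSet B0) (hr' : r ∉ quotSet Bs) :
    (Bs.card : ℝ) ^ 2 ≤ 16 * ((2 * Q / N) ^ 4 * V) := by
  have nz : ∀ b ∈ B0, b ≠ 0 := fun b hb e => h0 (e ▸ hB0A hb)
  obtain ⟨b1, m1, b2, m2, b3, m3, b4, m4, hne, rfl⟩ := hr
  have hsub := hBsB0.trans hB0A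
  obtain ⟨X, x1, x2, Y, y1, y2, hE⟩ := est4 A Bs Bs hsub hsub s hs N Q hN hQ b1 b2 b3 b4
    (nz _ m1) (nz _ m2) (nz _ m3) (nz _ m4) (hB0 _ m1) (hB0 _ m2) (hB0 _ m3) (hB0 _ m4)
  have hi := inj_card Bs X Y x1 y1 (b3 - b4) (s * (b1 - b2)) (sub_ne_zero.2 hne) (by
    intro hh
    rw [mul_div_assoc] at hh
    exact hr' (quot_sign _ _ _ hs hh))
  have hi' : (X.card : ℝ) * Y.card ≤ ((b3 - b4) • X + (s * (b1 - b2)) • Y).card := by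
    exact_mod_cast hi
  have x2' : (Bs.card : ℝ) ≤ 4 * X.card := by exact_mod_cast x2
  have y2' : (Bs.card : ℝ) ≤ 4 * Y.card := by exact_mod_cast y2
  have hQ0 : 0 ≤ Q := le_trans (by positivity) hQ
  calc (Bs.card : ℝ) ^ 2 = Bs.card * Bs.card := by ring
    _ ≤ (4 * X.card) * (4 * Y.card) := by gcongr
    _ = 16 * (X.card * Y.card) := by ring
    _ ≤ 16 * ((2 * Q / N) ^ 4 * (A + (s • A + s • A + s • A)).card) := by
      have := hi'.trans hE
      linarith
    _ ≤ _ := by gcongr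

lemma case1 (A B0 Bs : Finset F) (hB0A : B0 ⊆ A) (hBsB0 : Bs ⊆ B0) (h0 : (0:F) ∉ A)
    (s : F) (hs : s = 1 ∨ s = -1) (N Q V : ℝ) (hN : 0 < N)
    (hQ : ((A + s • A).card : ℝ) ≤ Q) (hV : ((A + (s • A + s • A + s • A)).card : ℝ) ≤ V)
    (hB0 : ∀ b ∈ B0, N ≤ (A.filter fun x => b * x ∈ A).card)
    (hBs : ∀ b ∈ Bs, N / 2 ≤ (B0.filter fun x => b * x ∈ A).card)
    (r : F) (hr : r ∈ quotSet Bs) (hr' : r + 1 ∉ quotSet B0) :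
    (Bs.card : ℝ) ^ 2 ≤ 1024 * ((2 * Q / N) ^ 4 * V) := by
  have nz : ∀ b ∈ Bs, b ≠ 0 := fun b hb e => h0 (e ▸ hB0A (hBsB0 hb))
  have hB0' : ∀ b ∈ Bs, N ≤ (A.filter fun x => b * x ∈ A).card := fun b hb => hB0 b (hBsB0 hb)
  obtain ⟨b1, m1, b2, m2, b3, m3, b4, m4, hne, hr0⟩ := hr
  set Y := B0.filter fun x => b1 * x ∈ A with hY
  have hYB : Y ⊆ B0 := Finset.filter_subset _ _
  obtain ⟨X1, x1, x2, Y1, y1, y2, hE⟩ := est3 A B0 Y hB0A (hYB.trans hB0A) s hs N Q hN hQ b1 b2 b3 b4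
    (nz _ m2) (nz _ m3) (nz _ m4) (fun y hy => (Finset.mem_filter.1 hy).2)
    (hB0' _ m2) (hB0' _ m3) (hB0' _ m4)
  have hc0 : b3 - b4 ≠ 0 := sub_ne_zero.2 hne
  have hs0 : s ≠ 0 := by rcases hs with rfl | rfl <;> simp
  have hcard : ((X1 + (s * r) • Y1).card : ℝ) =
      ((b3 - b4) • X1 + (s * (b1 - b2)) • Y1).card := by
    rw [← card_smul0 (b3 - b4) hc0 (X1 + (s * r) • Y1), smul_add, smul_smul]
    have : (b3 - b4) * (s * r) = s * (b1 - b2) := by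
      rw [hr0]; field_simp
    rw [this]
  rw [← hcard] at hE
  have hYc := hBs _ m1
  rw [← hY] at hYc
  have y2' : (Y.card : ℝ) ≤ 2 * Y1.card := by exact_mod_cast y2
  have x2' : (B0.card : ℝ) ≤ 4 * X1.card := by exact_mod_cast x2
  have hY1 : N / 4 ≤ Y1.card := by linarith
  have hY1n : Y1.Nonempty := by
    rw [← Finset.card_pos]
    have : (0:ℝ) < Y1.card := by linarith
    exact_mod_cast this
  have hX1n : X1.Nonempty := by
    rw [← Finset.card_pos]
    have : 0 < B0.card := Finset.card_pos.2 ⟨b1, hBsB0 m1⟩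
    omega
  obtain ⟨X2, z1, z2, hL⟩ := large2 X1 (s • Y1) ((s * r) • Y1) hX1n
    hY1n.smul_finset hY1n.smul_finset
  have z2' : (X1.card : ℝ) ≤ 2 * X2.card := by exact_mod_cast z2
  have hi := inj_card B0 X2 Y1 (z1.trans x1) (y1.trans hYB) 1 (s * (r + 1)) one_ne_zero (by
    rw [div_one]
    exact fun hh => hr' (quot_sign _ _ _ hs hh))
  have hsub : (1:F) • X2 + (s * (r + 1)) • Y1 ⊆ X2 + (s • Y1 + (s * r) • Y1) := by
    intro w hw
    obtain ⟨p, hp, q, hq, rfl⟩ := Finset.mem_add.1 hw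
    obtain ⟨x, hx, rfl⟩ := Finset.mem_smul_finset.1 hp
    obtain ⟨y, hy, rfl⟩ := Finset.mem_smul_finset.1 hq
    have : (1:F) • x + (s * (r + 1)) • y = x + (s • y + (s * r) • y) := by
      simp only [smul_eq_mul]; ring
    rw [this]
    exact Finset.add_mem_add hx (Finset.add_mem_add (Finset.smul_mem_smul_finset hy)
      (Finset.smul_mem_smul_finset hy))
  have hi' : (X2.card : ℝ) * Y1.card ≤ (X2 + (s • Y1 + (s * r) • Y1)).card := by
    exact_mod_cast hi.trans (Finset.card_le_card hsub)
  have hS : ((X1 + s • Y1).card : ℝ) ≤ Q := by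
    refine le_trans ?_ hQ
    have : (X1 + s • Y1).card ≤ (A + s • A).card := Finset.card_le_card
      (Finset.add_subset_add (x1.trans hB0A)
        (Finset.smul_finset_subset_smul_finset ((y1.trans hYB).trans hB0A)))
    exact_mod_cast this
  have hQ0 : 0 ≤ Q := le_trans (by positivity) hQ
  have hBc : (Bs.card : ℝ) ≤ B0.card := by exact_mod_cast Finset.card_le_card hBsB0
  have hE' : ((X1 + (s * r) • Y1).card : ℝ) ≤ (2 * Q / N) ^ 3 * V := hE.trans (by gcongr)
  have key : (X1.card : ℝ) * X1.card * N ≤ 128 * (Q * ((2 * Q / N) ^ 3 * V)) := by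
    have e1 : (X1.card : ℝ) / 2 * (N / 4) * X1.card ≤ X2.card * Y1.card * X1.card := by
      gcongr; linarith
    have e2 : (X2.card : ℝ) * Y1.card * X1.card ≤
        (X2 + (s • Y1 + (s * r) • Y1)).card * X1.card := by gcongr
    have e3 : 16 * ((X1 + s • Y1).card : ℝ) * (X1 + (s * r) • Y1).card ≤
        16 * Q * ((2 * Q / N) ^ 3 * V) := by gcongr
    linarith
  have k2 : (X1.card : ℝ) * X1.card ≤ 64 * ((2 * Q / N) ^ 4 * V) := by
    refine le_of_mul_le_mul_right (a := N) ?_ hN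
    refine key.trans (le_of_eq ?_)
    field_simp
    ring
  calc (Bs.card : ℝ) ^ 2 = Bs.card * Bs.card := by ring
    _ ≤ (4 * X1.card) * (4 * X1.card) := by gcongr <;> linarith
    _ = 16 * (X1.card * X1.card) := by ring
    _ ≤ 16 * (64 * ((2 * Q / N) ^ 4 * V)) := by gcongr
    _ = _ := by ring

lemma case2 (A B0 Bs : Finset F) (hB0A : B0 ⊆ A) (hBsB0 : Bs ⊆ B0) (h0 : (0:F) ∉ A)
    (s : F) (hs : s = 1 ∨ s = -1) (N Q V : ℝ) (hN : 0 < N)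
    (hQ : ((A + s • A).card : ℝ) ≤ Q) (hV : ((A + (s • A + s • A + s • A)).card : ℝ) ≤ V)
    (hB0 : ∀ b ∈ B0, N ≤ (A.filter fun x => b * x ∈ A).card)
    (hBs : ∀ b ∈ Bs, N / 2 ≤ (B0.filter fun x => b * x ∈ A).card)
    (r b : F) (hr : r ∈ quotSet Bs) (hb : b ∈ Bs) (hr' : b * r ∉ quotSet B0) :
    N ^ 2 ≤ 32 * ((2 * Q / N) ^ 3 * V) := by
  have nz : ∀ b ∈ Bs, b ≠ 0 := fun b hb e => h0 (e ▸ hB0A (hBsB0 hb))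
  have hB0' : ∀ b ∈ Bs, N ≤ (A.filter fun x => b * x ∈ A).card := fun b hb => hB0 b (hBsB0 hb)
  have hb0 := nz b hb
  obtain ⟨b1, m1, b2, m2, b3, m3, b4, m4, hne, hr0⟩ := hr
  have hr1 : r ≠ 0 := by
    rintro rfl
    exact hr' (by rw [mul_zero]; exact ⟨b1, hBsB0 m1, b1, hBsB0 m1, b3, hBsB0 m3, b4, hBsB0 m4, hne, by simp⟩)
  have hne' : b1 - b2 ≠ 0 := by
    intro h; rw [h, zero_div] at hr0; exact hr1 hr0
  have hne3 : b3 - b4 ≠ 0 := sub_ne_zero.2 hne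
  set Y := B0.filter fun x => b3 * x ∈ A with hY
  set X := B0.filter fun x => b * x ∈ A with hX
  have hYB : Y ⊆ B0 := Finset.filter_subset _ _
  have hXB : X ⊆ B0 := Finset.filter_subset _ _
  have hXA : b • X ⊆ A := by
    intro z hz
    obtain ⟨x, hx, rfl⟩ := Finset.mem_smul_finset.1 hz
    exact (Finset.mem_filter.1 hx).2
  obtain ⟨X1, x1, x2, Y1, y1, y2, hE⟩ := est3 A (b • X) Y hXA (hYB.trans hB0A) s hs N Q hN hQ
    b3 b4 b1 b2 (nz _ m4) (nz _ m1) (nz _ m2) (fun y hy => (Finset.mem_filter.1 hy).2)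
    (hB0' _ m4) (hB0' _ m1) (hB0' _ m2)
  rw [card_smul0 b hb0] at x2
  have hX1 : b • (b⁻¹ • X1) = X1 := by rw [smul_smul, mul_inv_cancel₀ hb0, one_smul]
  have hX2 : b⁻¹ • X1 ⊆ B0 := by
    intro z hz
    obtain ⟨w, hw, rfl⟩ := Finset.mem_smul_finset.1 hz
    obtain ⟨x, hx, rfl⟩ := Finset.mem_smul_finset.1 (x1 hw)
    rw [smul_smul, inv_mul_cancel₀ hb0, one_smul]
    exact hXB hx
  have hi := inj_card B0 (b⁻¹ • X1) Y1 hX2 (y1.trans hYB) ((b1 - b2) * b) (s * (b3 - b4))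
    (mul_ne_zero hne' hb0) (by
      intro hh
      apply hr'
      have e : s * (b3 - b4) / ((b1 - b2) * b) = s * (b * r)⁻¹ := by
        rw [hr0]; field_simp
      rw [e] at hh
      have := quot_inv _ _ (quot_sign _ _ _ hs hh)
      rwa [inv_inv] at this)
  rw [mul_smul, hX1, card_smul0 _ (inv_ne_zero hb0)] at hi
  have hi' : (X1.card : ℝ) * Y1.card ≤ ((b1 - b2) • X1 + (s * (b3 - b4)) • Y1).card := by
    exact_mod_cast hi
  have hYc := hBs _ m3
  have hXc := hBs _ hb
  rw [← hY] at hYc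
  rw [← hX] at hXc
  have x2' : (X.card : ℝ) ≤ 4 * X1.card := by exact_mod_cast x2
  have y2' : (Y.card : ℝ) ≤ 2 * Y1.card := by exact_mod_cast y2
  have hQ0 : 0 ≤ Q := le_trans (by positivity) hQ
  calc N ^ 2 = 32 * ((N / 8) * (N / 4)) := by ring
    _ ≤ 32 * (X1.card * Y1.card) := by gcongr <;> linarith
    _ ≤ 32 * ((2 * Q / N) ^ 3 * (A + (s • A + s • A + s • A)).card) := by
      have := hi'.trans hE
      linarith
    _ ≤ _ := by gcongr

lemma closure_field (B : Finset F) (h0 : (0:F) ∉ B) (hB : 2 ≤ B.card)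
    (h1 : ∀ r ∈ quotSet B, r + 1 ∈ quotSet B)
    (h2 : ∀ b ∈ B, ∀ r ∈ quotSet B, b * r ∈ quotSet B) :
    ∃ G : Subfield F, (∀ b ∈ B, b ∈ G) ∧ ∀ g ∈ G, g ∈ quotSet B := by
  obtain ⟨a, ha, b, hb, hab⟩ := Finset.one_lt_card.1 (show 1 < B.card by omega)
  have hz : (0:F) ∈ quotSet B := ⟨a, ha, a, ha, a, ha, b, hb, hab, by simp⟩
  let H : AddSubgroup F :=
    { carrier := {h | ∀ r ∈ quotSet B, r + h ∈ quotSet B}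
      zero_mem' := by intro r hr; simpa using hr
      add_mem' := by
        intro x y hx hy r hr
        rw [← add_assoc]
        exact hy _ (hx _ hr)
      neg_mem' := by
        intro x hx r hr
        have := quot_neg _ _ (hx _ (quot_neg _ _ hr))
        have e : -(-r + x) = r + -x := by ring
        rwa [e] at this }
  have hHmul : ∀ c ∈ B, ∀ h ∈ H, c * h ∈ H := by
    intro c hc h hh r hr
    have hc0 : c ≠ 0 := fun e => h0 (e ▸ hc)
    have e1 : c⁻¹ * r ∈ quotSet B := by
      have := quot_inv _ _ (h2 c hc _ (quot_inv _ _ hr))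
      rwa [mul_inv, inv_inv] at this
    have e2 := h2 c hc _ (hh _ e1)
    have e : c * (c⁻¹ * r + h) = r + c * h := by field_simp
    rwa [e] at e2
  -- the ring of multipliers of H
  let M : Subring F :=
    { carrier := {m | ∀ h ∈ H, m * h ∈ H}
      zero_mem' := by intro h _; rw [zero_mul]; exact H.zero_mem
      one_mem' := by intro h hh; rwa [one_mul]
      add_mem' := by
        intro x y hx hy h hh
        rw [add_mul]; exact H.add_mem (hx h hh) (hy h hh)
      neg_mem' := by
        intro x hx h hh
        rw [neg_mul]; exact H.neg_mem (hx h hh)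
      mul_mem' := by
        intro x y hx hy h hh
        rw [mul_assoc]; exact hx _ (hy h hh) }
  let G : Subfield F :=
    { M with
      inv_mem' := by
        intro x hx
        by_cases hx0 : x = 0
        · rw [hx0, inv_zero]; exact M.zero_mem
        · have h3 : x ^ (Fintype.card F - 2) ∈ M := M.pow_mem hx _
          have hc : 2 ≤ Fintype.card F := Fintype.one_lt_card
          have h4 : x⁻¹ = x ^ (Fintype.card F - 2) := by
            refine inv_eq_of_mul_eq_one_left ?_
            rw [← pow_succ, show Fintype.card F - 2 + 1 = Fintype.card F - 1 by omega]
            exact FiniteField.pow_card_sub_one_eq_one x hx0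
          rw [h4]; exact h3 }
  refine ⟨G, fun b hb h hh => hHmul b hb h hh, fun g hg => ?_⟩
  have h1H : (1:F) ∈ H := h1
  have hg1 : g * 1 ∈ H := hg 1 h1H
  have := hg1 0 hz
  simpa using this

/-- averaged energy -/
lemma energy_avg (B T : Finset F) (hT : T.Nonempty) (hT0 : (0:F) ∉ T) :
    ∃ t ∈ T, T.card * (((B ×ˢ B) ×ˢ (B ×ˢ B)).filter
      fun p => p.1.1 + t * p.2.1 = p.1.2 + t * p.2.2).card ≤
      T.card * B.card ^ 2 + B.card ^ 4 := by
  obtain ⟨t, ht, hmin⟩ := Finset.exists_min_image T (fun t => (((B ×ˢ B) ×ˢ (B ×ˢ B)).filter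
      fun p => p.1.1 + t * p.2.1 = p.1.2 + t * p.2.2).card) hT
  refine ⟨t, ht, ?_⟩
  have h1 := Finset.card_nsmul_le_sum T _ _ hmin
  rw [smul_eq_mul] at h1
  refine h1.trans ?_
  have h2 : ∀ t ∈ T, (((B ×ˢ B) ×ˢ (B ×ˢ B)).filter
      fun p => p.1.1 + t * p.2.1 = p.1.2 + t * p.2.2).card ≤ B.card ^ 2 +
      (((B ×ˢ B) ×ˢ (B ×ˢ B)).filter
      fun p => p.2.1 ≠ p.2.2 ∧ t = (p.1.2 - p.1.1) / (p.2.1 - p.2.2)).card := by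
    intro t ht
    have e : B.card ^ 2 = ((B ×ˢ B).image fun p => ((p.1, p.1), (p.2, p.2))).card := by
      rw [Finset.card_image_of_injective, Finset.card_product, sq]
      rintro ⟨a, b⟩ ⟨c, d⟩ h
      simp only [Prod.mk.injEq] at h
      rw [h.1.1, h.2.1]
    rw [e]
    refine le_trans (Finset.card_le_card ?_) (Finset.card_union_le _ _)
    rintro ⟨⟨a, b⟩, c, d⟩ hp
    simp only [Finset.mem_filter, Finset.mem_product] at hp
    obtain ⟨⟨⟨ha, hb⟩, hc, hd⟩, hp⟩ := hp
    by_cases hcd : c = d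
    · subst hcd
      have : a = b := by linear_combination hp
      subst this
      exact Finset.mem_union_left _ (Finset.mem_image.2 ⟨(a, c), Finset.mk_mem_product ha hc, rfl⟩)
    · refine Finset.mem_union_right _ (Finset.mem_filter.2 ⟨?_, hcd, ?_⟩)
      · simp [ha, hb, hc, hd]
      · rw [eq_div_iff (sub_ne_zero.2 hcd)]
        linear_combination hp
  refine (Finset.sum_le_sum h2).trans ?_
  rw [Finset.sum_add_distrib, Finset.sum_const, smul_eq_mul]
  gcongr
  have e4 : B.card ^ 4 = ((B ×ˢ B) ×ˢ (B ×ˢ B)).card := by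
    simp only [Finset.card_product]; ring
  rw [e4, ← Finset.card_biUnion]
  · apply Finset.card_le_card
    exact Finset.biUnion_subset.2 fun t _ => Finset.filter_subset _ _
  · intro t _ t' _ htt
    refine Finset.disjoint_left.2 fun p hp hp' => htt ?_
    rw [(Finset.mem_filter.1 hp).2.2, (Finset.mem_filter.1 hp').2.2]

lemma case3 (A B0 Bs : Finset F) (hB0A : B0 ⊆ A) (hBsB0 : Bs ⊆ B0) (h0 : (0:F) ∉ A)
    (hcard : 2 ≤ Bs.card)
    (s : F) (hs : s = 1 ∨ s = -1) (N Q V : ℝ) (hN : 0 < N)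
    (hQ : ((A + s • A).card : ℝ) ≤ Q) (hV : ((A + (s • A + s • A + s • A)).card : ℝ) ≤ V)
    (hB0 : ∀ b ∈ B0, N ≤ (A.filter fun x => b * x ∈ A).card)
    (G : Subfield F) (hG : ∀ g ∈ G, g ∈ quotSet Bs) :
    (Bs.card : ℝ) ^ 2 ≤
      256 * (1 + 2 * (Bs.card : ℝ) ^ 2 / Nat.card G) * ((2 * Q / N) ^ 4 * V) := by
  have nz : ∀ b ∈ Bs, b ≠ 0 := fun b hb e => h0 (e ▸ hB0A (hBsB0 hb))
  have hB0' : ∀ b ∈ Bs, N ≤ (A.filter fun x => b * x ∈ A).card := fun b hb => hB0 b (hBsB0 hb)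
  have hsub := hBsB0.trans hB0A
  have hss : s * s = 1 := by rcases hs with rfl | rfl <;> simp
  set GG : Finset F := Finset.univ.filter fun x => x ∈ G with hGG
  have hGc : Nat.card G = GG.card := by
    rw [Nat.card_eq_fintype_card, Fintype.card_subtype]
  set T := GG.erase 0 with hT
  have hTc : T.card + 1 = GG.card := Finset.card_erase_add_one (by simp [hGG])
  have h1T : (1:F) ∈ T := by simp [hT, hGG]
  obtain ⟨t, ht, hE⟩ := energy_avg Bs T ⟨1, h1T⟩ (by simp [hT])
  have htG : t ∈ G := by
    have := Finset.mem_of_mem_erase ht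
    simpa [hGG] using this
  have hstG : s * t ∈ G := by
    refine G.mul_mem ?_ htG
    rcases hs with rfl | rfl
    · exact G.one_mem
    · exact G.neg_mem G.one_mem
  obtain ⟨b1, m1, b2, m2, b3, m3, b4, m4, hne, hr0⟩ := hG _ hstG
  have hc0 : b3 - b4 ≠ 0 := sub_ne_zero.2 hne
  obtain ⟨X, x1, x2, Y, y1, y2, hEst⟩ := est4 A Bs Bs hsub hsub s hs N Q hN hQ b1 b2 b3 b4
    (nz _ m1) (nz _ m2) (nz _ m3) (nz _ m4) (hB0' _ m1) (hB0' _ m2) (hB0' _ m3) (hB0' _ m4)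
  have ht0 : t ≠ 0 := Finset.ne_of_mem_erase ht
  have hcd : ((X + t • Y).card : ℝ) = ((b3 - b4) • X + (s * (b1 - b2)) • Y).card := by
    rw [← card_smul0 (b3 - b4) hc0 (X + t • Y), smul_add, smul_smul]
    have : (b3 - b4) * t = s * (b1 - b2) := by
      have : b1 - b2 = s * t * (b3 - b4) := by rw [hr0]; field_simp
      rw [this]
      linear_combination -(t * (b3 - b4)) * hss
    rw [this]
  rw [← hcd] at hEst
  have hCS := Finset.le_card_add_mul_addEnergy X (t • Y)
  rw [card_smul0 t ht0] at hCS
  set En := (((Bs ×ˢ Bs) ×ˢ (Bs ×ˢ Bs)).filter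
      fun p => p.1.1 + t * p.2.1 = p.1.2 + t * p.2.2).card with hEn
  have hle : Finset.addEnergy X (t • Y) ≤ En := by
    rw [Finset.addEnergy, hEn]
    refine Finset.card_le_card_of_injOn
      (fun p => (p.1, (t⁻¹ * p.2.1, t⁻¹ * p.2.2))) ?_ ?_
    · rintro ⟨⟨a, b⟩, c, d⟩ hp
      simp only [Finset.coe_filter, Finset.mem_product, Set.mem_setOf_eq] at hp ⊢
      obtain ⟨⟨⟨ha, hb⟩, hc, hd⟩, hp⟩ := hp
      obtain ⟨c, hc', rfl⟩ := Finset.mem_smul_finset.1 hc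
      obtain ⟨d, hd', rfl⟩ := Finset.mem_smul_finset.1 hd
      simp only [smul_eq_mul] at hp ⊢
      rw [inv_mul_cancel_left₀ ht0, inv_mul_cancel_left₀ ht0]
      exact ⟨⟨⟨x1 ha, x1 hb⟩, y1 hc', y1 hd'⟩, hp⟩
    · rintro ⟨⟨a, b⟩, c, d⟩ _ ⟨⟨a', b'⟩, c', d'⟩ _ hh
      simp only [Prod.mk.injEq, mul_right_inj' (inv_ne_zero ht0)] at hh ⊢
      exact hh
  have x2' : (Bs.card : ℝ) ≤ 4 * X.card := by exact_mod_cast x2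
  have y2' : (Bs.card : ℝ) ≤ 4 * Y.card := by exact_mod_cast y2
  have hQ0 : 0 ≤ Q := le_trans (by positivity) hQ
  have hV0 : 0 ≤ V := le_trans (by positivity) hV
  set n : ℝ := (Bs.card : ℝ) with hn
  have hn0 : 0 < n := by
    have : 0 < Bs.card := by omega
    rw [hn]; exact_mod_cast this
  have hCS' : (X.card : ℝ) ^ 2 * Y.card ^ 2 ≤ (X + t • Y).card * En := by
    have : X.card ^ 2 * Y.card ^ 2 ≤ (X + t • Y).card * En := hCS.trans (by gcongr)
    exact_mod_cast this
  have hTpos : 0 < T.card := Finset.card_pos.2 ⟨1, h1T⟩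
  set g : ℝ := (Nat.card G : ℝ) with hg
  have hTg : g ≤ 2 * T.card := by
    rw [hg, hGc]
    have : GG.card ≤ 2 * T.card := by omega
    exact_mod_cast this
  have hg0 : 0 < g := by
    rw [hg, hGc]
    have : 0 < GG.card := by omega
    exact_mod_cast this
  have hEr : (T.card : ℝ) * En ≤ T.card * n ^ 2 + n ^ 4 := by
    rw [hn]; exact_mod_cast hE
  have hTr : (0:ℝ) < T.card := by exact_mod_cast hTpos
  have hEb : (En : ℝ) ≤ n ^ 2 * (1 + 2 * n ^ 2 / g) := by
    have e1 : (En : ℝ) ≤ n ^ 2 + n ^ 4 / T.card := by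
      rw [← sub_le_iff_le_add', le_div_iff₀ hTr]
      linarith
    have e2 : n ^ 4 / T.card ≤ n ^ 4 * 2 / g := by
      rw [div_le_div_iff₀ hTr hg0]
      have : 0 ≤ n ^ 4 := by positivity
      nlinarith
    calc (En : ℝ) ≤ n ^ 2 + n ^ 4 * 2 / g := by linarith
      _ = _ := by field_simp
  have key : n ^ 4 ≤ 256 * (((2 * Q / N) ^ 4 * V) * (n ^ 2 * (1 + 2 * n ^ 2 / g))) := by
    calc n ^ 4 = n ^ 2 * n ^ 2 := by ring
      _ ≤ (4 * (X.card : ℝ)) ^ 2 * (4 * (Y.card : ℝ)) ^ 2 := by gcongr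
      _ = 256 * ((X.card : ℝ) ^ 2 * (Y.card : ℝ) ^ 2) := by ring
      _ ≤ 256 * (((X + t • Y).card : ℝ) * En) := by gcongr
      _ ≤ 256 * (((2 * Q / N) ^ 4 * V) * (n ^ 2 * (1 + 2 * n ^ 2 / g))) := by
        gcongr
        exact hEst.trans (by gcongr)
  refine le_of_mul_le_mul_right (a := n ^ 2) ?_ (by positivity)
  calc n ^ 2 * n ^ 2 = n ^ 4 := by ring
    _ ≤ _ := key
    _ = _ := by ring

/-- full core dichotomy -/
lemma core (A B0 Bs : Finset F) (hB0A : B0 ⊆ A) (hBsB0 : Bs ⊆ B0) (h0 : (0:F) ∉ A)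
    (hcard : 2 ≤ Bs.card)
    (s : F) (hs : s = 1 ∨ s = -1) (N Q V : ℝ) (hN : 0 < N)
    (hQ : ((A + s • A).card : ℝ) ≤ Q) (hV : ((A + (s • A + s • A + s • A)).card : ℝ) ≤ V)
    (hB0 : ∀ b ∈ B0, N ≤ (A.filter fun x => b * x ∈ A).card)
    (hBs : ∀ b ∈ Bs, N / 2 ≤ (B0.filter fun x => b * x ∈ A).card) :
    (Bs.card : ℝ) ^ 2 ≤ 1024 * ((2 * Q / N) ^ 4 * V) ∨
    N ^ 2 ≤ 32 * ((2 * Q / N) ^ 3 * V) ∨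
    ∃ G : Subfield F, (∀ b ∈ Bs, b ∈ G) ∧ (Bs.card : ℝ) ^ 2 ≤
      256 * (1 + 2 * (Bs.card : ℝ) ^ 2 / Nat.card G) * ((2 * Q / N) ^ 4 * V) := by
  have hQ0 : 0 ≤ Q := le_trans (by positivity) hQ
  have hV0 : 0 ≤ V := le_trans (by positivity) hV
  by_cases c0 : ∀ r ∈ quotSet B0, r ∈ quotSet Bs
  swap
  · push Not at c0
    obtain ⟨r, hr, hr'⟩ := c0
    left
    refine (case0 A B0 Bs hB0A hBsB0 h0 s hs N Q V hN hQ hV hB0 r hr hr').trans ?_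
    gcongr; norm_num
  by_cases c1 : ∀ r ∈ quotSet Bs, r + 1 ∈ quotSet Bs
  swap
  · push Not at c1
    obtain ⟨r, hr, hr'⟩ := c1
    left
    exact case1 A B0 Bs hB0A hBsB0 h0 s hs N Q V hN hQ hV hB0 hBs r hr (fun h => hr' (c0 _ h))
  by_cases c2 : ∀ b ∈ Bs, ∀ r ∈ quotSet Bs, b * r ∈ quotSet Bs
  swap
  · push Not at c2
    obtain ⟨b, hb, r, hr, hr'⟩ := c2
    right; left
    exact case2 A B0 Bs hB0A hBsB0 h0 s hs N Q V hN hQ hV hB0 hBs r b hr hb (fun h => hr' (c0 _ h))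
  obtain ⟨G, g1, g2⟩ := closure_field Bs (fun h => h0 (hB0A (hBsB0 h))) hcard c1 c2
  exact Or.inr (Or.inr ⟨G, g1,
    case3 A B0 Bs hB0A hBsB0 h0 hcard s hs N Q V hN hQ hV hB0 G g2⟩)

end Core

section Final
variable [Fintype F]

lemma per_x (A : Finset F) (N : ℝ) (hN : 0 < N) (B0 Bs NR : Finset F)
    (hB0 : B0 = A.filter fun b => N ≤ (A.filter fun x => b * x ∈ A).card)
    (hBs : Bs = B0.filter fun b => N / 2 ≤ (B0.filter fun x => b * x ∈ A).card)
    (hNR : NR = A.filter fun b => ¬ N ≤ (A.filter fun x => b * x ∈ A).card) :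
    A.card ≤ Bs.card + 3 * NR.card := by
  set BAD := B0.filter fun b => ¬ N / 2 ≤ (B0.filter fun x => b * x ∈ A).card with hBAD
  have e1 : B0.card + NR.card = A.card := by
    rw [hB0, hNR]; exact Finset.card_filter_add_card_filter_not _
  have e2 : Bs.card + BAD.card = B0.card := by
    rw [hBs, hBAD]; exact Finset.card_filter_add_card_filter_not _
  have hdc := Finset.sum_card_bipartiteAbove_eq_sum_card_bipartiteBelow
    (fun y z : F => y * z ∈ A) (s := BAD) (t := NR)
  have h1 : (BAD.card : ℝ) * (N / 2) ≤
      ((∑ y ∈ BAD, (NR.bipartiteAbove (fun y z : F => y * z ∈ A) y).card : ℕ) : ℝ) := by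
    rw [Nat.cast_sum, ← nsmul_eq_mul]
    apply Finset.card_nsmul_le_sum
    intro y hy
    obtain ⟨hy0, hy1⟩ := Finset.mem_filter.1 hy
    have hy2 : N ≤ (A.filter fun x => y * x ∈ A).card := by
      rw [hB0] at hy0; exact (Finset.mem_filter.1 hy0).2
    have hsub : (A.filter fun x => y * x ∈ A) ⊆
        (B0.filter fun x => y * x ∈ A) ∪ NR.bipartiteAbove (fun y z : F => y * z ∈ A) y := by
      intro z hz
      obtain ⟨hz, hz'⟩ := Finset.mem_filter.1 hz
      by_cases hr : N ≤ (A.filter fun x => z * x ∈ A).card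
      · refine Finset.mem_union_left _ (Finset.mem_filter.2 ⟨?_, hz'⟩)
        rw [hB0]; exact Finset.mem_filter.2 ⟨hz, hr⟩
      · refine Finset.mem_union_right _ (Finset.mem_filter.2 ⟨?_, hz'⟩)
        rw [hNR]; exact Finset.mem_filter.2 ⟨hz, hr⟩
    have hc := (Finset.card_le_card hsub).trans (Finset.card_union_le _ _)
    have hc' : ((A.filter fun x => y * x ∈ A).card : ℝ) ≤
        (B0.filter fun x => y * x ∈ A).card +
          (NR.bipartiteAbove (fun y z : F => y * z ∈ A) y).card := by exact_mod_cast hc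
    push Not at hy1
    linarith
  have h2 : ((∑ z ∈ NR, (BAD.bipartiteBelow (fun y z : F => y * z ∈ A) z).card : ℕ) : ℝ) ≤
      NR.card * N := by
    rw [Nat.cast_sum, ← nsmul_eq_mul]
    apply Finset.sum_le_card_nsmul
    intro z hz
    rw [hNR] at hz
    have hz' := (Finset.mem_filter.1 hz).2
    push Not at hz'
    refine le_trans ?_ hz'.le
    have : (BAD.bipartiteBelow (fun y z : F => y * z ∈ A) z).card ≤
        (A.filter fun x => z * x ∈ A).card := by
      apply Finset.card_le_card
      intro y hy
      obtain ⟨hy, hy'⟩ := Finset.mem_filter.1 hy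
      have hy0 := (Finset.mem_filter.1 hy).1
      rw [hB0] at hy0
      exact Finset.mem_filter.2 ⟨(Finset.mem_filter.1 hy0).1, by rw [mul_comm]; exact hy'⟩
    exact_mod_cast this
  rw [hdc] at h1
  have h3 : (BAD.card : ℝ) * (N / 2) ≤ NR.card * N := h1.trans h2
  have h4 : (BAD.card : ℝ) ≤ 2 * NR.card := by
    refine le_of_mul_le_mul_right (a := N / 2) ?_ (by positivity)
    linarith
  have h5 : BAD.card ≤ 2 * NR.card := by exact_mod_cast h4
  omega

lemma filt_smul (A : Finset F) (x : F) (hx : x ≠ 0) (b : F) :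
    ((x⁻¹ • A).filter fun z => b * z ∈ x⁻¹ • A).card = (A.filter fun z => b * z ∈ A).card := by
  rw [← card_smul0 x⁻¹ (inv_ne_zero hx) (A.filter fun z => b * z ∈ A)]
  congr 1
  ext z
  simp only [Finset.mem_filter, Finset.mem_smul_finset, smul_eq_mul]
  constructor
  · rintro ⟨⟨y, hy, rfl⟩, w, hw, e⟩
    refine ⟨y, ⟨hy, ?_⟩, rfl⟩
    have : b * y = w := by
      refine mul_left_cancel₀ (inv_ne_zero hx) ?_
      linear_combination -e
    rw [this]; exact hw
  · rintro ⟨y, ⟨hy, hby⟩, rfl⟩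
    exact ⟨⟨y, hy, rfl⟩, b * y, hby, by ring⟩

lemma avg (A : Finset F) (h0 : (0:F) ∉ A) (hA : A.Nonempty) (N : ℝ) (hN : 0 < N)
    (h : 8 * N * (A / A).card ≤ (A.card : ℝ) ^ 2) :
    ∃ x ∈ A, 8 * ((x⁻¹ • A).filter fun b =>
      ¬ N ≤ ((x⁻¹ • A).filter fun z => b * z ∈ x⁻¹ • A).card).card ≤ A.card := by
  by_contra hcon
  have hcon : ∀ x ∈ A, A.card < 8 * ((x⁻¹ • A).filter fun b =>
      ¬ N ≤ ((x⁻¹ • A).filter fun z => b * z ∈ x⁻¹ • A).card).card :=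
    fun x hx => not_le.1 fun h => hcon ⟨x, hx, h⟩
  set P := (A / A).filter fun ξ => ¬ N ≤ (A.filter fun z => ξ * z ∈ A).card with hP
  have hdc := Finset.sum_card_bipartiteAbove_eq_sum_card_bipartiteBelow
    (fun x ξ : F => ξ * x ∈ A) (s := A) (t := P)
  have h1 : ∀ x ∈ A, ((x⁻¹ • A).filter fun b =>
      ¬ N ≤ ((x⁻¹ • A).filter fun z => b * z ∈ x⁻¹ • A).card).card ≤
      (P.bipartiteAbove (fun x ξ : F => ξ * x ∈ A) x).card := by
    intro x hx
    have hx0 : x ≠ 0 := fun e => h0 (e ▸ hx)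
    apply Finset.card_le_card
    intro b hb
    obtain ⟨hb, hb'⟩ := Finset.mem_filter.1 hb
    rw [filt_smul A x hx0] at hb'
    obtain ⟨y, hy, rfl⟩ := Finset.mem_smul_finset.1 hb
    refine Finset.mem_filter.2 ⟨Finset.mem_filter.2 ⟨?_, hb'⟩, ?_⟩
    · rw [smul_eq_mul, mul_comm, ← div_eq_mul_inv]; exact Finset.div_mem_div hy hx
    · rw [smul_eq_mul]
      have : x⁻¹ * y * x = y := by field_simp
      show x⁻¹ * y * x ∈ A
      rw [this]; exact hy
  have h2 : ((∑ ξ ∈ P, (A.bipartiteBelow (fun x ξ : F => ξ * x ∈ A) ξ).card : ℕ) : ℝ) ≤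
      P.card * N := by
    rw [Nat.cast_sum, ← nsmul_eq_mul]
    apply Finset.sum_le_card_nsmul
    intro z hz
    have hz' := (Finset.mem_filter.1 hz).2
    push Not at hz'
    exact hz'.le
  have hPc : (P.card : ℝ) ≤ (A / A).card := by
    exact_mod_cast Finset.card_le_card (Finset.filter_subset _ _)
  have h3 : ∑ x ∈ A, A.card < ∑ x ∈ A, 8 * (P.bipartiteAbove (fun x ξ : F => ξ * x ∈ A) x).card :=
    Finset.sum_lt_sum_of_nonempty hA fun x hx => by
      have := hcon x hx
      have := h1 x hx
      omega
  rw [← Finset.mul_sum, hdc, Finset.sum_const, smul_eq_mul] at h3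
  have h4 : (A.card : ℝ) * A.card < 8 *
    ((∑ ξ ∈ P, (A.bipartiteBelow (fun x ξ : F => ξ * x ∈ A) ξ).card : ℕ) : ℝ) := by
    exact_mod_cast h3
  have h5 : (P.card : ℝ) * N ≤ (A / A).card * N := by gcongr
  nlinarith

lemma prep (A0 : Finset F) (h0 : (0:F) ∉ A0) (hne : A0.Nonempty) (s : F) (hs : s = 1 ∨ s = -1) :
    ∃ A B0 Bs : Finset F, ∃ x0 : F, x0 ≠ 0 ∧ B0 ⊆ A ∧ Bs ⊆ B0 ∧ (0:F) ∉ A ∧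
      5 * A0.card ≤ 16 * Bs.card ∧ (∀ b ∈ Bs, x0 * b ∈ A0) ∧
      (A + s • A).card ≤ (A0 + s • A0).card ∧
      ((A + (s • A + s • A + s • A)).card : ℝ) ≤ 8 * (A0 + s • A0).card ^ 3 / A0.card ^ 2 ∧
      (∀ b ∈ B0, (A0.card : ℝ) ^ 2 / (32 * (A0 / A0).card) ≤ (A.filter fun x => b * x ∈ A).card) ∧
      (∀ b ∈ Bs, (A0.card : ℝ) ^ 2 / (32 * (A0 / A0).card) / 2 ≤
        (B0.filter fun x => b * x ∈ A).card) := by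
  obtain ⟨A, hA, hAc, hA3⟩ := large3 A0 (s • A0) hne
  have hM : (0:ℝ) < A0.card := by exact_mod_cast hne.card_pos
  have hR : (0:ℝ) < (A0 / A0).card := by exact_mod_cast (hne.div hne).card_pos
  have hAne : A.Nonempty := by
    rw [← Finset.card_pos]; have := hne.card_pos; omega
  have hA00 : (0:F) ∉ A := fun h => h0 (hA h)
  set N : ℝ := (A0.card : ℝ) ^ 2 / (32 * (A0 / A0).card) with hN
  have hN0 : 0 < N := by positivity
  have hRA : ((A / A).card : ℝ) ≤ (A0 / A0).card := by
    exact_mod_cast Finset.card_le_card (Finset.div_subset_div hA hA)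
  have hAc' : (A0.card : ℝ) ≤ 2 * A.card := by exact_mod_cast hAc
  obtain ⟨x, hx, hx8⟩ := avg A hA00 hAne N hN0 (by
    calc 8 * N * (A / A).card ≤ 8 * N * (A0 / A0).card := by gcongr
      _ = (A0.card / 2 : ℝ) ^ 2 := by rw [hN]; field_simp; norm_num
      _ ≤ _ := by gcongr; linarith)
  have hx0 : x ≠ 0 := fun e => hA00 (e ▸ hx)
  have hxi := inv_ne_zero hx0
  set A' := x⁻¹ • A with hA'
  have hpx := per_x A' N hN0 _ _ _ rfl rfl rfl
  have hA'c : A'.card = A.card := card_smul0 _ hxi _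
  refine ⟨A', _, _, x, hx0, Finset.filter_subset _ _, Finset.filter_subset _ _, ?_, ?_, ?_, ?_, ?_,
    fun b hb => (Finset.mem_filter.1 hb).2, fun b hb => (Finset.mem_filter.1 hb).2⟩
  · intro h
    obtain ⟨y, hy, e⟩ := Finset.mem_smul_finset.1 h
    rcases mul_eq_zero.1 e with h | h
    · exact hxi h
    · exact hA00 (h ▸ hy)
  · omega
  · intro b hb
    have hb := (Finset.mem_filter.1 (Finset.mem_filter.1 hb).1).1
    obtain ⟨y, hy, rfl⟩ := Finset.mem_smul_finset.1 hb
    rw [smul_eq_mul, mul_inv_cancel_left₀ hx0]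
    exact hA hy
  · have : A' + s • A' = x⁻¹ • (A + s • A) := by
      rw [smul_add, hA', smul_comm s]
    rw [this, card_smul0 _ hxi]
    exact Finset.card_le_card (Finset.add_subset_add hA (Finset.smul_finset_subset_smul_finset hA))
  · have : A' + (s • A' + s • A' + s • A') = x⁻¹ • (A + (s • A + s • A + s • A)) := by
      rw [smul_add, smul_add, smul_add, hA', smul_comm s]
    rw [this, card_smul0 _ hxi, le_div_iff₀ (by positivity)]
    refine le_trans ?_ hA3
    have hsA : s • A ⊆ s • A0 := Finset.smul_finset_subset_smul_finset hA
    have : (A + (s • A + s • A + s • A)).card ≤ (A + (s • A0 + s • A0 + s • A0)).card :=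
      Finset.card_le_card (Finset.add_subset_add_left
        (Finset.add_subset_add (Finset.add_subset_add hsA hsA) hsA))
    gcongr

set_option maxHeartbeats 2000000 in
lemma part1 (A0 : Finset F) (h0 : (0:F) ∉ A0) (h2 : 2 ≤ A0.card) (s : F) (hs : s = 1 ∨ s = -1)
    (η C : ℝ) (hη : η < 1 / 8) (hC : 0 < C)
    (hq : (A0.card : ℝ) ≤ (Fintype.card F : ℝ) ^ ((1:ℝ)/2))
    (hG : ∀ G : Subfield F, G ≠ ⊤ → ∀ cc : F,
        ((A0.filter fun x => ∃ g ∈ G, x = cc * g).card : ℝ) ≤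
          max (C * (Nat.card G : ℝ) ^ ((1:ℝ)/2)) (η * (A0.card : ℝ))) :
    (A0.card : ℝ) ^ 12 ≤ (11 * 1024 * (3 + 2 * C ^ 2) * 2 ^ 27) *
      ((A0 + s • A0).card ^ 7 * (A0 / A0).card ^ 4) ∨
    (A0.card : ℝ) ^ 12 ≤ (11 * 1024 * (3 + 2 * C ^ 2) * 2 ^ 27) *
      ((A0 + s • A0).card ^ 6 * (A0 / A0).card ^ 5) := by
  have hne : A0.Nonempty := Finset.card_pos.1 (by omega)
  have hs0 : s ≠ 0 := by rcases hs with rfl | rfl <;> simp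
  have hM : (0:ℝ) < A0.card := by exact_mod_cast hne.card_pos
  have hR : (0:ℝ) < (A0 / A0).card := by exact_mod_cast (hne.div hne).card_pos
  have hSM : (A0.card : ℝ) ≤ (A0 + s • A0).card := by
    have : A0.card ≤ (A0 + s • A0).card :=
      Finset.card_le_card_add_right (s := A0) (t := s • A0) hne.smul_finset
    exact_mod_cast this
  have hRM : (A0.card : ℝ) ≤ (A0 / A0).card := by
    obtain ⟨x, hx⟩ := hne
    have hx0 : x ≠ 0 := fun e => h0 (e ▸ hx)
    have : A0.card ≤ (A0 / A0).card := by
      refine Finset.card_le_card_of_injOn (fun y => y / x) ?_ ?_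
      · intro y hy
        exact Finset.mem_coe.2 (Finset.div_mem_div (Finset.mem_coe.1 hy) hx)
      · intro y _ z _ e
        exact (div_left_inj' hx0).1 e
    exact_mod_cast this
  obtain ⟨A, B0, Bs, x0, hx0, hB0A, hBsB0, hA00, hcard, hx0A, hS, hV, hB0, hBs⟩ :=
    prep A0 h0 hne s hs
  set M : ℝ := (A0.card : ℝ) with hMdef
  set S : ℝ := ((A0 + s • A0).card : ℝ) with hSdef
  set R : ℝ := ((A0 / A0).card : ℝ) with hRdef
  have hSpos : 0 < S := hM.trans_le hSM
  by_cases hsmall : A0.card ≤ 6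
  · left
    have hM6 : M ≤ 6 := by rw [hMdef]; exact_mod_cast hsmall
    calc M ^ 12 = M * (M ^ 7 * M ^ 4) := by ring
      _ ≤ 6 * (S ^ 7 * R ^ 4) := by gcongr
      _ ≤ _ := by
        gcongr
        nlinarith [sq_nonneg C]
  have hBsc : 2 ≤ Bs.card := by omega
  have hn : 5 * M ≤ 16 * Bs.card := by rw [hMdef]; exact_mod_cast hcard
  set n : ℝ := (Bs.card : ℝ) with hndef
  have hn0 : 0 < n := by linarith
  set N : ℝ := M ^ 2 / (32 * R) with hN
  have hN0 : 0 < N := by positivity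
  have hW : (2 * S / N) ^ 4 * (8 * S ^ 3 / M ^ 2) = 2 ^ 27 * (S ^ 7 * R ^ 4) / M ^ 10 := by
    rw [hN]; field_simp; norm_num
  have fin : ∀ K : ℝ, 0 ≤ K → K ≤ 1024 * (3 + 2 * C ^ 2) →
      n ^ 2 ≤ K * ((2 * S / N) ^ 4 * (8 * S ^ 3 / M ^ 2)) →
      M ^ 12 ≤ (11 * 1024 * (3 + 2 * C ^ 2) * 2 ^ 27) * (S ^ 7 * R ^ 4) := by
    intro K hK0 hK h
    rw [hW] at h
    have e1 : (5 * M) ^ 2 ≤ (16 * n) ^ 2 := by gcongr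
    have e2 : M ^ 2 ≤ 11 * n ^ 2 := by nlinarith [sq_nonneg n]
    have e3 : M ^ 2 ≤ 11 * ((1024 * (3 + 2 * C ^ 2)) * (2 ^ 27 * (S ^ 7 * R ^ 4) / M ^ 10)) := by
      refine e2.trans ?_
      gcongr
      exact h.trans (by gcongr)
    calc M ^ 12 = M ^ 2 * M ^ 10 := by ring
      _ ≤ 11 * ((1024 * (3 + 2 * C ^ 2)) * (2 ^ 27 * (S ^ 7 * R ^ 4) / M ^ 10)) * M ^ 10 := by
        gcongr
      _ = _ := by field_simp
  have hS' : ((A + s • A).card : ℝ) ≤ S := by rw [hSdef]; exact_mod_cast hS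
  rcases core A B0 Bs hB0A hBsB0 hA00 hBsc s hs N S _ hN0 hS' hV hB0 hBs with h | h | ⟨G, hGB, h⟩
  · left
    exact fin 1024 (by norm_num) (by nlinarith [sq_nonneg C]) h
  · right
    have hW3 : (2 * S / N) ^ 3 * (8 * S ^ 3 / M ^ 2) = 2 ^ 21 * (S ^ 6 * R ^ 3) / M ^ 8 := by
      rw [hN]; field_simp; norm_num
    rw [hW3, hN] at h
    have e : M ^ 12 ≤ 2 ^ 36 * (S ^ 6 * R ^ 5) := by
      have e2 : (M ^ 2 / (32 * R)) ^ 2 * (2 ^ 10 * R ^ 2 * M ^ 8) ≤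
        32 * (2 ^ 21 * (S ^ 6 * R ^ 3) / M ^ 8) * (2 ^ 10 * R ^ 2 * M ^ 8) := by gcongr
      calc M ^ 12 = (M ^ 2 / (32 * R)) ^ 2 * (2 ^ 10 * R ^ 2 * M ^ 8) := by field_simp; norm_num
        _ ≤ _ := e2
        _ = _ := by field_simp; norm_num
    refine e.trans ?_
    gcongr
    nlinarith [sq_nonneg C]
  · left
    have hg0 : (0:ℝ) < Nat.card G := by exact_mod_cast Nat.card_pos
    have himg : Bs.card ≤ (A0.filter fun x => ∃ g ∈ G, x = x0 * g).card := by
      rw [← card_smul0 x0 hx0 Bs]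
      apply Finset.card_le_card
      intro z hz
      obtain ⟨b, hb, rfl⟩ := Finset.mem_smul_finset.1 hz
      exact Finset.mem_filter.2 ⟨hx0A b hb, b, hGB b hb, rfl⟩
    have himg' : n ≤ (A0.filter fun x => ∃ g ∈ G, x = x0 * g).card := by
      rw [hndef]; exact_mod_cast himg
    have sqr : ∀ x : ℝ, 0 ≤ x → (x ^ ((1:ℝ)/2)) ^ 2 = x := by
      intro x hx
      rw [← Real.sqrt_eq_rpow, Real.sq_sqrt hx]
    have hng : n ^ 2 ≤ (1 + C ^ 2) * Nat.card G := by
      by_cases hT : G = ⊤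
      · have hGq : (Nat.card G : ℝ) = Fintype.card F := by
          subst hT
          rw [← Nat.card_eq_fintype_card]
          exact_mod_cast Nat.card_congr (Subfield.topEquiv (K := F)).toEquiv
        have hnM : n ≤ M := himg'.trans (by
          rw [hMdef]; exact_mod_cast Finset.card_le_card (Finset.filter_subset _ _))
        have : n ^ 2 ≤ ((Fintype.card F : ℝ) ^ ((1:ℝ)/2)) ^ 2 := by
          gcongr; exact hnM.trans hq
        rw [sqr _ (by positivity), ← hGq] at this
        nlinarith [sq_nonneg C]
      · have h3 := himg'.trans (hG G hT x0)
        rcases le_max_iff.1 h3 with h3 | h3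
        · have : n ^ 2 ≤ (C * (Nat.card G : ℝ) ^ ((1:ℝ)/2)) ^ 2 := by gcongr
          rw [mul_pow, sqr _ hg0.le] at this
          linarith
        · exfalso
          nlinarith
    refine fin (256 * (1 + 2 * n ^ 2 / Nat.card G)) (by positivity) ?_ h
    have : 2 * n ^ 2 / Nat.card G ≤ 2 * (1 + C ^ 2) := by
      rw [div_le_iff₀ hg0]; linarith
    nlinarith [sq_nonneg C]

set_option maxHeartbeats 1000000 in
lemma part2 (A0 : Finset F) (h0 : (0:F) ∉ A0) (h2 : 2 ≤ A0.card) (s : F) (hs : s = 1 ∨ s = -1)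
    (η : ℝ) (hη0 : 0 < η) (hη : η < 1 / 8)
    (hq : η⁻¹ * (Fintype.card F : ℝ) ^ ((1:ℝ)/2) < (A0.card : ℝ)) :
    (A0.card : ℝ) ^ 10 * Fintype.card F ≤ (768 * 2 ^ 27) *
      ((A0 + s • A0).card ^ 7 * (A0 / A0).card ^ 4) := by
  have hne : A0.Nonempty := Finset.card_pos.1 (by omega)
  have hM : (0:ℝ) < A0.card := by exact_mod_cast hne.card_pos
  have hR : (0:ℝ) < (A0 / A0).card := by exact_mod_cast (hne.div hne).card_pos
  obtain ⟨A, B0, Bs, x0, hx0, hB0A, hBsB0, hA00, hcard, hx0A, hS, hV, hB0, hBs⟩ :=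
    prep A0 h0 hne s hs
  have hSM : (A0.card : ℝ) ≤ (A0 + s • A0).card := by
    have : A0.card ≤ (A0 + s • A0).card :=
      Finset.card_le_card_add_right (s := A0) (t := s • A0) hne.smul_finset
    exact_mod_cast this
  set M : ℝ := (A0.card : ℝ) with hMdef
  set S : ℝ := ((A0 + s • A0).card : ℝ) with hSdef
  set R : ℝ := ((A0 / A0).card : ℝ) with hRdef
  have hSpos : 0 < S := hM.trans_le hSM
  have hn : 5 * M ≤ 16 * Bs.card := by rw [hMdef]; exact_mod_cast hcard
  set N : ℝ := M ^ 2 / (32 * R) with hN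
  have hN0 : 0 < N := by positivity
  have hW : (2 * S / N) ^ 4 * (8 * S ^ 3 / M ^ 2) = 2 ^ 27 * (S ^ 7 * R ^ 4) / M ^ 10 := by
    rw [hN]; field_simp; norm_num
  set q : ℝ := (Fintype.card F : ℝ) with hqdef
  have hq1 : 1 ≤ q := by
    rw [hqdef]; exact_mod_cast Fintype.card_pos
  have hsq : (q ^ ((1:ℝ)/2)) ^ 2 = q := by
    rw [← Real.sqrt_eq_rpow, Real.sq_sqrt (by linarith)]
  set w := q ^ ((1:ℝ)/2) with hw
  have hw1 : 1 ≤ w := by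
    rw [hw]; exact Real.one_le_rpow hq1 (by norm_num)
  have hi : 8 < η⁻¹ := by
    rw [lt_inv_comm₀ (by norm_num) hη0]; linarith
  have h8 : 8 * w < M := lt_of_le_of_lt (by gcongr) hq
  have hnw : 2 * w < Bs.card := by linarith
  have hBsc : 2 ≤ Bs.card := by
    have : (2:ℝ) < Bs.card := by linarith
    have : 2 < Bs.card := by exact_mod_cast this
    omega
  have hnq : q < (Bs.card : ℝ) ^ 2 := by
    rw [← hsq]
    gcongr
    linarith
  have hquot : ∀ g ∈ (⊤ : Subfield F), g ∈ quotSet Bs := by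
    intro t _
    by_contra ht
    have hi := inj_card Bs Bs Bs subset_rfl subset_rfl 1 t one_ne_zero (by rwa [div_one])
    have h5 := hi.trans (Finset.card_le_univ _)
    have h6 : (Bs.card : ℝ) * Bs.card ≤ q := by rw [hqdef]; exact_mod_cast h5
    nlinarith
  have hS' : ((A + s • A).card : ℝ) ≤ S := by rw [hSdef]; exact_mod_cast hS
  have h := case3 A B0 Bs hB0A hBsB0 hA00 hBsc s hs N S _ hN0 hS' hV hB0 ⊤ hquot
  have hGq : (Nat.card (⊤ : Subfield F) : ℝ) = q := by
    rw [hqdef, ← Nat.card_eq_fintype_card]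
    exact_mod_cast Nat.card_congr (Subfield.topEquiv (K := F)).toEquiv
  rw [hGq, hW] at h
  set n : ℝ := (Bs.card : ℝ) with hndef
  have hn0 : 0 < n := by linarith
  have e1 : 1 + 2 * n ^ 2 / q ≤ 3 * n ^ 2 / q := by
    have : 1 ≤ n ^ 2 / q := by rw [one_le_div (by linarith)]; exact hnq.le
    have e : 3 * n ^ 2 / q = n ^ 2 / q + 2 * n ^ 2 / q := by ring
    linarith
  have e2 : n ^ 2 ≤ 256 * (3 * n ^ 2 / q) * (2 ^ 27 * (S ^ 7 * R ^ 4) / M ^ 10) :=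
    h.trans (by gcongr)
  have hq0 : 0 < q := by linarith
  refine le_of_mul_le_mul_left (a := n ^ 2) ?_ (by positivity)
  calc n ^ 2 * (M ^ 10 * q) ≤
      256 * (3 * n ^ 2 / q) * (2 ^ 27 * (S ^ 7 * R ^ 4) / M ^ 10) * (M ^ 10 * q) := by gcongr
    _ = _ := by field_simp; norm_num

lemma sub_eq_smul (A : Finset F) : A - A = A + (-1 : F) • A := by
  ext z
  simp only [Finset.mem_sub, Finset.mem_add, Finset.mem_smul_finset, smul_eq_mul]
  constructor
  · rintro ⟨a, ha, b, hb, rfl⟩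
    exact ⟨a, ha, _, ⟨b, hb, rfl⟩, by ring⟩
  · rintro ⟨a, ha, _, ⟨b, hb, rfl⟩, rfl⟩
    exact ⟨a, ha, b, hb, by ring⟩

end Final


theorem stmt13 : ∀ η C : ℝ, 0 < η → η < 1/8 → 0 < C → ∃ c : ℝ, 0 < c ∧
    ∀ (F : Type) [Field F] [Fintype F] (q : ℕ), IsPrimePow q → Fintype.card F = q →
    ∀ A : Finset F, 2 ≤ A.card → (0:F) ∉ A →
    (((A.card : ℝ) ≤ (q : ℝ) ^ ((1:ℝ)/2) →
      (∀ G : Subfield F, G ≠ ⊤ → ∀ cc : F,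
        ((A.filter fun x => ∃ g ∈ G, x = cc * g).card : ℝ) ≤
          max (C * (Nat.card G : ℝ) ^ ((1:ℝ)/2)) (η * (A.card : ℝ))) →
      ((c * (A.card : ℝ) ^ (12:ℕ) ≤ (((A + A).card : ℝ)) ^ (7:ℕ) * (((A / A).card : ℝ)) ^ (4:ℕ) ∨
        c * (A.card : ℝ) ^ (12:ℕ) ≤ (((A + A).card : ℝ)) ^ (6:ℕ) * (((A / A).card : ℝ)) ^ (5:ℕ)) ∧
       (c * (A.card : ℝ) ^ (12:ℕ) ≤ (((A - A).card : ℝ)) ^ (7:ℕ) * (((A / A).card : ℝ)) ^ (4:ℕ) ∨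
        c * (A.card : ℝ) ^ (12:ℕ) ≤ (((A - A).card : ℝ)) ^ (6:ℕ) * (((A / A).card : ℝ)) ^ (5:ℕ)))) ∧
     (η⁻¹ * (q : ℝ) ^ ((1:ℝ)/2) < (A.card : ℝ) →
      c * (A.card : ℝ) ^ (10:ℕ) * (q : ℝ) ≤ (((A + A).card : ℝ)) ^ (7:ℕ) * (((A / A).card : ℝ)) ^ (4:ℕ) ∧
      c * (A.card : ℝ) ^ (10:ℕ) * (q : ℝ) ≤ (((A - A).card : ℝ)) ^ (7:ℕ) * (((A / A).card : ℝ)) ^ (4:ℕ))) := by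
  intro η C hη0 hη hC
  have hK : (0:ℝ) < 11 * 1024 * (3 + 2 * C ^ 2) * 2 ^ 27 := by positivity
  refine ⟨(11 * 1024 * (3 + 2 * C ^ 2) * 2 ^ 27)⁻¹, by positivity, ?_⟩
  intro F _ _ q _ hqF A h2 h0
  subst hqF
  have hle : ∀ x y : ℝ, x ≤ 11 * 1024 * (3 + 2 * C ^ 2) * 2 ^ 27 * y →
      (11 * 1024 * (3 + 2 * C ^ 2) * 2 ^ 27)⁻¹ * x ≤ y := fun x y h =>
    (inv_mul_le_iff₀ hK).2 h
  have h1A : A + A = A + (1:F) • A := by rw [one_smul]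
  constructor
  · intro hq hG
    have k1 := part1 A h0 h2 1 (Or.inl rfl) η C hη hC hq hG
    have k2 := part1 A h0 h2 (-1) (Or.inr rfl) η C hη hC hq hG
    rw [← h1A] at k1
    rw [← sub_eq_smul] at k2
    exact ⟨k1.imp (hle _ _) (hle _ _), k2.imp (hle _ _) (hle _ _)⟩
  · intro hq
    have k1 := part2 A h0 h2 1 (Or.inl rfl) η hη0 hη hq
    have k2 := part2 A h0 h2 (-1) (Or.inr rfl) η hη0 hη hq
    rw [← h1A] at k1
    rw [← sub_eq_smul] at k2
    have hKK : (768 * 2 ^ 27 : ℝ) ≤ 11 * 1024 * (3 + 2 * C ^ 2) * 2 ^ 27 := by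
      nlinarith [sq_nonneg C]
    constructor
    · rw [mul_assoc]
      exact hle _ _ (k1.trans (by gcongr))
    · rw [mul_assoc]
      exact hle _ _ (k2.trans (by gcongr))



end STP
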